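/- Let s ≥ 4 and m be natural numbers, and let A be a non-empty subset of S_{3,m}. Define λ_s = 2^{−1} · 3^{−s/2 + 2} when s is even and λ_s = 10^{−1} · 3^{−(s−1)/2 + 3} when s is odd. Then for every ε > 0 there is a constant C(s, ε) > 0, independent of m and A, such that r_s(A) ≤ C(s, ε) · m^ε · |A|^{s − 3 + 1/2 + λ_s}. -/

import Mathlib

open Finset

noncomputable section

/-- The set of lattice points on the sphere of radius `√m` in `ℤ^d`. -/
def latSphere (d m : ℕ) : Set (Fin d → ℤ) := {x | ∑ i, x i ^ 2 = (m : ℤ)}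

/-- The additive energy `E_{s,2}(A)`: the number of `2s`-tuples
`(x₁, …, x_{2s}) ∈ A^{2s}` with `x₁ + ⋯ + x_s = x_{s+1} + ⋯ + x_{2s}`. -/
def addEnergy {V : Type*} [AddCommMonoid V] (s : ℕ) (A : Set V) : ℕ :=
  Nat.card {p : (Fin s → V) × (Fin s → V) //
    (∀ i, p.1 i ∈ A) ∧ (∀ i, p.2 i ∈ A) ∧ ∑ i, p.1 i = ∑ i, p.2 i}

/-- The representation function `r_s(A, n)`: the number of `s`-tuples
`(x₁, …, x_s) ∈ A^s` with `x₁ + ⋯ + x_s = n`. -/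
def repCount {V : Type*} [AddCommMonoid V] (s : ℕ) (A : Set V) (n : V) : ℕ :=
  Nat.card {x : Fin s → V // (∀ i, x i ∈ A) ∧ ∑ i, x i = n}


theorem card_divisors_bound (ε : ℝ) (hε : 0 < ε) :
    ∃ C : ℝ, 1 ≤ C ∧ ∀ n : ℕ, n ≠ 0 → ((n.divisors.card : ℕ) : ℝ) ≤ C * (n : ℝ) ^ ε := by
  set K : ℝ := 1 + 1 / (ε * Real.log 2) with hK
  have hl2 : 0 < Real.log 2 := Real.log_pos (by norm_num)
  have hK1 : 1 ≤ K := by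
    have : 0 ≤ 1 / (ε * Real.log 2) := by positivity
    linarith
  set P : ℕ := ⌈(2 : ℝ) ^ (1 / ε)⌉₊ with hP
  have key : ∀ (p : ℕ), p.Prime → ∀ v : ℕ, ((v : ℝ) + 1) ≤
      (if p < P then K else 1) * ((p : ℝ) ^ v) ^ ε := by
    intro p hp v
    have hp2 : (2 : ℝ) ≤ p := by exact_mod_cast hp.two_le
    have hcomm : ((p : ℝ) ^ v) ^ ε = ((p : ℝ) ^ ε) ^ v := by
      rw [← Real.rpow_natCast, ← Real.rpow_natCast, ← Real.rpow_mul (by positivity),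
        ← Real.rpow_mul (by positivity), mul_comm]
    split_ifs with h
    · have h1 : (2 : ℝ) ^ (ε * v) ≤ ((p : ℝ) ^ v) ^ ε := by
        rw [hcomm, Real.rpow_mul (by norm_num), Real.rpow_natCast]
        gcongr
      have h2 : 1 + (v * (ε * Real.log 2)) ≤ (2 : ℝ) ^ (ε * v) := by
        rw [Real.rpow_def_of_pos (by norm_num)]
        have := Real.add_one_le_exp (Real.log 2 * (ε * v))
        nlinarith
      have h3 : (v : ℝ) + 1 ≤ K * (1 + (v * (ε * Real.log 2))) := by
        have h0 : 0 < ε * Real.log 2 := by positivity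
        have : K * (1 + (v * (ε * Real.log 2)))
          = 1 + v * (ε * Real.log 2) + 1 / (ε * Real.log 2) + v := by
          rw [hK]; field_simp; ring
        rw [this]
        have : 0 ≤ v * (ε * Real.log 2) + 1 / (ε * Real.log 2) := by positivity
        linarith
      calc (v : ℝ) + 1 ≤ K * (1 + (v * (ε * Real.log 2))) := h3
        _ ≤ K * ((p : ℝ) ^ v) ^ ε := by gcongr; linarith
    · rw [one_mul, hcomm]
      have h1 : (2 : ℝ) ^ (1 / ε) ≤ p := by
        have := Nat.le_ceil ((2 : ℝ) ^ (1 / ε))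
        have h' : (P : ℝ) ≤ p := by exact_mod_cast (not_lt.mp h)
        linarith
      have h2 : (2 : ℝ) ≤ (p : ℝ) ^ ε := by
        calc (2 : ℝ) = ((2 : ℝ) ^ (1 / ε)) ^ ε := by
              rw [← Real.rpow_mul (by norm_num)]; field_simp; simp
          _ ≤ _ := by gcongr
      calc (v : ℝ) + 1 ≤ (2 : ℝ) ^ v := by
            exact_mod_cast Nat.lt_two_pow_self
        _ ≤ _ := by gcongr
  refine ⟨K ^ P, one_le_pow₀ hK1, ?_⟩
  intro n hn
  rw [Nat.card_divisors hn]
  push_cast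
  calc ∏ p ∈ n.primeFactors, ((n.factorization p : ℝ) + 1)
      ≤ ∏ p ∈ n.primeFactors, ((if p < P then K else 1) * ((p : ℝ) ^ (n.factorization p)) ^ ε) := by
        apply Finset.prod_le_prod
        · intros; positivity
        · intro p hp
          exact key p (Nat.prime_of_mem_primeFactors hp) _
    _ = (∏ p ∈ n.primeFactors, (if p < P then K else 1)) *
        (n : ℝ) ^ ε := by
        rw [Finset.prod_mul_distrib]
        congr 1
        rw [Real.finsetProd_rpow _ _ (by intros; positivity)]
        congr 1
        conv_rhs => rw [← Nat.prod_factorization_pow_eq_self hn]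
        rw [Finsupp.prod]
        push_cast
        rfl
    _ ≤ K ^ P * (n : ℝ) ^ ε := by
        gcongr
        rw [← Finset.prod_filter, Finset.prod_const]
        apply pow_le_pow_right₀ hK1
        calc _ ≤ (Finset.range P).card := by
              apply Finset.card_le_card
              intro p hp
              simp at hp ⊢
              exact hp.2
          _ = P := by simp

/-- primitive representations -/
theorem two_of_sq_dvd (D x y N d : ℤ) (hD : Squarefree D) (hN : x ^ 2 + D * y ^ 2 = N)
    (hxy : IsCoprime x y) (h1 : d ∣ 2 * x) (h2 : d * d ∣ N) : d ∣ 2 := by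
  have aux : ∀ e : ℤ, e ∣ x → e * e ∣ N → IsUnit e := by
    intro e he hee
    apply hD
    have hy : IsCoprime e y := hxy.of_isCoprime_of_dvd_left he
    have h3 : e * e ∣ D * y ^ 2 := by
      have : D * y ^ 2 = N - x ^ 2 := by linarith
      rw [this]
      apply dvd_sub hee
      rw [sq]; exact mul_dvd_mul he he
    have : IsCoprime (e * e) (y ^ 2) := by
      apply IsCoprime.pow_right
      exact hy.mul_left hy
    exact this.dvd_of_dvd_mul_right h3
  rcases Int.even_or_odd' d with ⟨e, he | he⟩
  · have hx : e ∣ x := by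
      rw [he] at h1
      exact (mul_dvd_mul_iff_left (by norm_num)).mp h1
    have hN' : e * e ∣ N := by
      refine dvd_trans ⟨4, ?_⟩ h2
      rw [he]; ring
    have := aux e hx hN'
    rw [he]
    rcases Int.isUnit_iff.mp this with h | h <;> simp [h]
  · have hc : IsCoprime d 2 := ⟨1, -e, by rw [he]; ring⟩
    have hx : d ∣ x := hc.dvd_of_dvd_mul_left h1
    exact (aux d hx h2).dvd

theorem prim_count (D : ℤ) (hD0 : 0 < D) (hD : Squarefree D) (N : ℕ) (hN : 0 < N)
    (S : Finset (ℤ × ℤ)) (hS : ∀ v ∈ S, v.1 ^ 2 + D * v.2 ^ 2 = N ∧ IsCoprime v.1 v.2) :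
    S.card ≤ 10 * N.divisors.card := by
  rcases S.eq_empty_or_nonempty with rfl | ⟨v0, hv0⟩
  · simp
  obtain ⟨x0, y0⟩ := v0
  obtain ⟨h0, hc0⟩ := hS _ hv0
  simp only at h0 hc0
  have hy0 : IsCoprime (N : ℤ) y0 := by
    rw [← h0]
    have : IsCoprime (x0 ^ 2) y0 := hc0.pow_left
    have h3 := this.add_mul_right_left (D * y0)
    have e : x0 ^ 2 + D * y0 ^ 2 = x0 ^ 2 + D * y0 * y0 := by ring
    rw [e]; exact h3
  have hdiv : ∀ a b : ℤ, (N : ℤ) ∣ a * b → ((N : ℤ) / (Int.gcd N a)) ∣ b := by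
    intro a b h
    have hg : 0 < Int.gcd N a := Int.gcd_pos_of_ne_zero_left _ (by exact_mod_cast hN.ne')
    have hcop : IsCoprime ((N : ℤ) / (Int.gcd N a)) (a / (Int.gcd N a)) := by
      rw [Int.isCoprime_iff_gcd_eq_one]
      exact Int.gcd_ediv_gcd_ediv_gcd hg
    apply hcop.dvd_of_dvd_mul_left
    have hg' : ((Int.gcd N a : ℕ) : ℤ) ≠ 0 := by exact_mod_cast hg.ne'
    apply (mul_dvd_mul_iff_left hg').mp
    rw [Int.mul_ediv_cancel' (Int.gcd_dvd_left ..)]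
    rw [← mul_assoc, Int.mul_ediv_cancel' (Int.gcd_dvd_right ..)]
    exact h
  set φ : ℤ × ℤ → ℕ := fun v => Int.gcd N (v.1 * y0 - x0 * v.2) with hφ
  have him : S.image φ ⊆ N.divisors := by
    intro g hg
    simp only [Finset.mem_image] at hg
    obtain ⟨v, hv, rfl⟩ := hg
    rw [Nat.mem_divisors]
    refine ⟨?_, hN.ne'⟩
    have := Int.gcd_dvd_left (a := (N : ℤ)) (b := (v.1 * y0 - x0 * v.2))
    exact_mod_cast this
  calc S.card ≤ 10 * (S.image φ).card := by
        apply Finset.card_le_mul_card_image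
        intro g hg
        simp only [Finset.mem_image] at hg
        obtain ⟨⟨x1, y1⟩, hv1, hg1⟩ := hg
        obtain ⟨h1, hc1⟩ := hS _ hv1
        simp only [hφ] at hg1 h1 hc1
        have key : ∀ x y : ℤ, (x, y) ∈ S → φ (x, y) = g → ∃ j ∈ Finset.Icc (-2 : ℤ) 2,
            2 * (x1 * y - x * y1) = j * N := by
          intro x y hv hg
          obtain ⟨h, hc⟩ := hS _ hv
          simp only [hφ] at hg h hc
          have ga : (g : ℤ) ∣ x * y0 - x0 * y := by rw [← hg]; exact Int.gcd_dvd_right ..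
          have ga1 : (g : ℤ) ∣ x1 * y0 - x0 * y1 := by rw [← hg1]; exact Int.gcd_dvd_right ..
          have gN : (g : ℤ) ∣ N := by rw [← hg]; exact Int.gcd_dvd_left ..
          have hb : (N : ℤ) / g ∣ x * y0 + x0 * y := by
            rw [← hg]; apply hdiv
            refine ⟨y0 ^ 2 - y ^ 2, ?_⟩
            linear_combination y0 ^ 2 * h - y ^ 2 * h0
          have hb1 : (N : ℤ) / g ∣ x1 * y0 + x0 * y1 := by
            rw [← hg1]; apply hdiv
            refine ⟨y0 ^ 2 - y1 ^ 2, ?_⟩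
            linear_combination y0 ^ 2 * h1 - y1 ^ 2 * h0
          obtain ⟨q, hq⟩ := gN
          have hg0 : (g : ℤ) ≠ 0 := by
            rintro h; rw [h, zero_mul] at hq; exact hN.ne' (by exact_mod_cast hq)
          have hq' : (N : ℤ) / g = q := by rw [hq]; exact Int.mul_ediv_cancel_left _ hg0
          rw [hq'] at hb hb1
          have gD : (g : ℤ) ∣ x1 * y - x * y1 := by
            have hcg : IsCoprime (g : ℤ) y0 := hy0.of_isCoprime_of_dvd_left ⟨q, hq⟩
            apply hcg.dvd_of_dvd_mul_left
            have : y0 * (x1 * y - x * y1) = (x1 * y0 - x0 * y1) * y - (x * y0 - x0 * y) * y1 := by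
              ring
            rw [this]
            exact dvd_sub (Dvd.dvd.mul_right ga1 _) (Dvd.dvd.mul_right ga _)
          have qD : q ∣ x1 * y - x * y1 := by
            have hcg : IsCoprime q y0 := hy0.of_isCoprime_of_dvd_left ⟨g, by rw [hq]; ring⟩
            apply hcg.dvd_of_dvd_mul_left
            have : y0 * (x1 * y - x * y1) = (x1 * y0 + x0 * y1) * y - (x * y0 + x0 * y) * y1 := by
              ring
            rw [this]
            exact dvd_sub (Dvd.dvd.mul_right hb1 _) (Dvd.dvd.mul_right hb _)
          have hd2 : ((Int.gcd g q : ℕ) : ℤ) ∣ 2 := by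
            have e1 : ((Int.gcd g q : ℕ) : ℤ) ∣ g := Int.gcd_dvd_left ..
            have e2 : ((Int.gcd g q : ℕ) : ℤ) ∣ q := Int.gcd_dvd_right ..
            have hdN : ((Int.gcd g q : ℕ) : ℤ) * ((Int.gcd g q : ℕ) : ℤ) ∣ N := by
              rw [hq]; exact mul_dvd_mul e1 e2
            refine two_of_sq_dvd D x y N _ hD h hc ?_ hdN
            have hcg : IsCoprime ((Int.gcd g q : ℕ) : ℤ) y0 :=
              hy0.of_isCoprime_of_dvd_left (dvd_trans e1 ⟨q, hq⟩)
            apply hcg.dvd_of_dvd_mul_left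
            have : y0 * (2 * x) = (x * y0 - x0 * y) + (x * y0 + x0 * y) := by ring
            rw [this]
            exact dvd_add (e1.trans ga) (e2.trans hb)
          have hND : (N : ℤ) ∣ 2 * (x1 * y - x * y1) := by
            have h3 : (N : ℤ) ∣ ((Int.gcd g q : ℕ) : ℤ) * (x1 * y - x * y1) := by
              rw [Int.gcd_eq_gcd_ab, add_mul]
              apply dvd_add
              · rw [hq, mul_assoc]
                apply mul_dvd_mul_left
                exact Dvd.dvd.mul_left qD _
              · rw [hq, mul_comm (g : ℤ) q, mul_assoc]
                apply mul_dvd_mul_left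
                exact Dvd.dvd.mul_left gD _
            exact h3.trans (mul_dvd_mul_right hd2 _)
          obtain ⟨j, hj⟩ := hND
          refine ⟨j, ?_, by rw [hj]; ring⟩
          have hid : (x1 * x + D * y1 * y) ^ 2 + D * (x1 * y - x * y1) ^ 2 = (N : ℤ) ^ 2 := by
            calc _ = (x1 ^ 2 + D * y1 ^ 2) * (x ^ 2 + D * y ^ 2) := by ring
              _ = _ := by rw [h, h1]; ring
          have hle : (x1 * y - x * y1) ^ 2 ≤ (N : ℤ) ^ 2 := by
            nlinarith [sq_nonneg (x1 * x + D * y1 * y), sq_nonneg (x1 * y - x * y1)]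
          have hN0 : (0 : ℤ) < (N : ℤ) ^ 2 := by positivity
          have hj4 : j ^ 2 ≤ 4 := by
            have : (N : ℤ) ^ 2 * j ^ 2 ≤ (N : ℤ) ^ 2 * 4 := by
              have e : (N : ℤ) ^ 2 * j ^ 2 = 4 * (x1 * y - x * y1) ^ 2 := by
                calc _ = ((N : ℤ) * j) ^ 2 := by ring
                  _ = _ := by rw [← hj]; ring
              rw [e]; linarith
            exact le_of_mul_le_mul_left this hN0
          rw [Finset.mem_Icc]
          constructor <;> nlinarith
        set T := (Finset.Icc (-2 : ℤ) 2) ×ˢ (Finset.univ : Finset Bool) with hT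
        have hTc : T.card = 10 := by rw [hT]; rfl
        rw [← hTc]
        apply Finset.card_le_card_of_injOn
          (fun v => ((2 * (x1 * v.2 - v.1 * y1)) / (N : ℤ), decide (0 ≤ x1 * v.1 + D * y1 * v.2)))
        · rintro ⟨x, y⟩ hv
          simp only [Finset.coe_filter, Set.mem_ofPred_eq] at hv
          obtain ⟨j, hj, hj'⟩ := key x y hv.1 hv.2
          simp only [hT, Finset.coe_product, Set.mem_prod]
          refine ⟨?_, Finset.mem_coe.mpr (Finset.mem_univ _)⟩
          simp only [hj']
          rw [Int.mul_ediv_cancel _ (by exact_mod_cast hN.ne')]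
          exact hj
        · rintro ⟨x, y⟩ hv ⟨x', y'⟩ hv' heq
          simp only [Finset.coe_filter, Set.mem_ofPred_eq] at hv hv'
          obtain ⟨j, hj, hj'⟩ := key x y hv.1 hv.2
          obtain ⟨i, hi, hi'⟩ := key x' y' hv'.1 hv'.2
          obtain ⟨h, hc⟩ := hS _ hv.1
          obtain ⟨h', hc'⟩ := hS _ hv'.1
          simp only at h h'
          have hNz : (N : ℤ) ≠ 0 := by exact_mod_cast hN.ne'
          simp only [Prod.mk.injEq, decide_eq_decide] at heq
          obtain ⟨he1, he2⟩ := heq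
          rw [hj', hi', Int.mul_ediv_cancel _ hNz, Int.mul_ediv_cancel _ hNz] at he1
          have hΔ : x1 * y - x * y1 = x1 * y' - x' * y1 := by
            rw [he1] at hj'; linarith
          have hid : (x1 * x + D * y1 * y) ^ 2 + D * (x1 * y - x * y1) ^ 2 = (N : ℤ) ^ 2 := by
            calc _ = (x1 ^ 2 + D * y1 ^ 2) * (x ^ 2 + D * y ^ 2) := by ring
              _ = _ := by rw [h, h1]; ring
          have hid' : (x1 * x' + D * y1 * y') ^ 2 + D * (x1 * y' - x' * y1) ^ 2 = (N : ℤ) ^ 2 := by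
            calc _ = (x1 ^ 2 + D * y1 ^ 2) * (x' ^ 2 + D * y' ^ 2) := by ring
              _ = _ := by rw [h', h1]; ring
          have hB : x1 * x + D * y1 * y = x1 * x' + D * y1 * y' := by
            have hsq : (x1 * x + D * y1 * y) ^ 2 = (x1 * x' + D * y1 * y') ^ 2 := by
              rw [hΔ] at hid; linarith
            rcases sq_eq_sq_iff_eq_or_eq_neg.mp hsq with h | h
            · exact h
            · by_cases hp : 0 ≤ x1 * x + D * y1 * y
              · have := he2.mp hp; linarith
              · have h3 : ¬ (0 ≤ x1 * x' + D * y1 * y') := fun h => hp (he2.mpr h)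
                linarith
          have hx : (N : ℤ) * x = N * x' := by
            rw [← h1]; linear_combination x1 * hB - D * y1 * hΔ
          have hy : (N : ℤ) * y = N * y' := by
            rw [← h1]; linear_combination y1 * hB + x1 * hΔ
          rw [Prod.mk.injEq]
          exact ⟨mul_left_cancel₀ hNz hx, mul_left_cancel₀ hNz hy⟩
    _ ≤ 10 * N.divisors.card := by gcongr


theorem sqfree_count (D : ℤ) (hD0 : 0 < D) (hD : Squarefree D) (c : ℕ) (hc : 0 < c)
    (S : Finset (ℤ × ℤ)) (hS : ∀ v ∈ S, v.1 ^ 2 + D * v.2 ^ 2 = c) :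
    S.card ≤ 10 * c.divisors.card ^ 2 := by
  set φ : ℤ × ℤ → ℕ := fun v => Int.gcd v.1 v.2 with hφ
  have hdv : ∀ v ∈ S, φ v ^ 2 ∣ c := by
    intro v hv
    have h1 : ((φ v : ℕ) : ℤ) ∣ v.1 := Int.gcd_dvd_left ..
    have h2 : ((φ v : ℕ) : ℤ) ∣ v.2 := Int.gcd_dvd_right ..
    have : (((φ v) ^ 2 : ℕ) : ℤ) ∣ c := by
      rw [← hS v hv]
      push_cast
      exact dvd_add (pow_dvd_pow_of_dvd h1 2) (Dvd.dvd.mul_left (pow_dvd_pow_of_dvd h2 2) _)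
    exact_mod_cast this
  have him : S.image φ ⊆ c.divisors := by
    intro g hg
    simp only [Finset.mem_image] at hg
    obtain ⟨v, hv, rfl⟩ := hg
    rw [Nat.mem_divisors]
    exact ⟨(dvd_pow_self _ two_ne_zero).trans (hdv v hv), hc.ne'⟩
  calc S.card ≤ (10 * c.divisors.card) * (S.image φ).card := by
        apply Finset.card_le_mul_card_image
        intro g hg
        simp only [Finset.mem_image] at hg
        obtain ⟨v1, hv1, hg1⟩ := hg
        have hgc : g ^ 2 ∣ c := hg1 ▸ hdv v1 hv1
        have hg0 : 0 < g := by
          rcases Nat.eq_zero_or_pos g with h | h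
          · rw [h] at hgc; simp at hgc; omega
          · exact h
        have hgz : (g : ℤ) ≠ 0 := by exact_mod_cast hg0.ne'
        obtain ⟨N, hN⟩ := hgc
        have hN0 : 0 < N := Nat.pos_of_ne_zero (by rintro rfl; simp at hN; omega)
        have hcard : (S.filter (fun v => φ v = g)).card =
            ((S.filter (fun v => φ v = g)).image
              (fun v : ℤ × ℤ => (v.1 / (g : ℤ), v.2 / (g : ℤ)))).card := by
          rw [Finset.card_image_of_injOn]
          rintro ⟨x, y⟩ hv ⟨x', y'⟩ hv' heq
          simp only [Finset.coe_filter, Set.mem_ofPred_eq] at hv hv'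
          simp only [Prod.mk.injEq] at heq ⊢
          have h1 : (g : ℤ) ∣ x := by rw [← hv.2]; exact Int.gcd_dvd_left ..
          have h2 : (g : ℤ) ∣ y := by rw [← hv.2]; exact Int.gcd_dvd_right ..
          have h1' : (g : ℤ) ∣ x' := by rw [← hv'.2]; exact Int.gcd_dvd_left ..
          have h2' : (g : ℤ) ∣ y' := by rw [← hv'.2]; exact Int.gcd_dvd_right ..
          exact ⟨(Int.ediv_left_inj h1 h1').mp heq.1, (Int.ediv_left_inj h2 h2').mp heq.2⟩
        rw [hcard]
        calc _ ≤ 10 * N.divisors.card := by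
              apply prim_count D hD0 hD N hN0
              intro u hu
              simp only [Finset.mem_image, Finset.mem_filter] at hu
              obtain ⟨⟨x, y⟩, ⟨hv, hvg⟩, rfl⟩ := hu
              have h1 : (g : ℤ) ∣ x := by rw [← hvg]; exact Int.gcd_dvd_left ..
              have h2 : (g : ℤ) ∣ y := by rw [← hvg]; exact Int.gcd_dvd_right ..
              have hq := hS _ hv
              constructor
              · obtain ⟨a, rfl⟩ := h1
                obtain ⟨b, rfl⟩ := h2
                simp only [Int.mul_ediv_cancel_left _ hgz]
                simp only [hN] at hq
                push_cast at hq
                have hg2 : (g : ℤ) ^ 2 ≠ 0 := pow_ne_zero _ hgz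
                apply mul_left_cancel₀ hg2
                linarith
              · rw [Int.isCoprime_iff_gcd_eq_one]
                have := Int.gcd_ediv_gcd_ediv_gcd (i := x) (j := y) (by
                  have : Int.gcd x y = g := hvg
                  omega)
                have e : Int.gcd x y = g := hvg
                rw [e] at this
                exact this
          _ ≤ 10 * c.divisors.card := by
              gcongr
              exact ⟨g ^ 2, by rw [hN]; ring⟩
    _ ≤ (10 * c.divisors.card) * c.divisors.card := by gcongr
    _ = _ := by ring

theorem rep_count (D : ℕ) (hD0 : 0 < D) (c : ℕ) (hc : 0 < c)
    (S : Finset (ℤ × ℤ)) (hS : ∀ v ∈ S, v.1 ^ 2 + (D : ℤ) * v.2 ^ 2 = c) :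
    S.card ≤ 10 * c.divisors.card ^ 2 := by
  obtain ⟨D', f, hDf, hsq⟩ := Nat.sq_mul_squarefree D
  have hf0 : (f : ℤ) ≠ 0 := by
    rintro h
    have : f = 0 := by exact_mod_cast h
    rw [this] at hDf; simp at hDf; omega
  have hD'0 : 0 < D' := Nat.pos_of_ne_zero (by rintro rfl; simp at hDf; omega)
  have hcard : S.card = (S.image (fun v : ℤ × ℤ => (v.1, (f : ℤ) * v.2))).card := by
    rw [Finset.card_image_of_injective]
    rintro ⟨x, y⟩ ⟨x', y'⟩ h
    simp only [Prod.mk.injEq] at h ⊢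
    exact ⟨h.1, mul_left_cancel₀ hf0 h.2⟩
  rw [hcard]
  apply sqfree_count (D' : ℤ) (by exact_mod_cast hD'0) (Int.squarefree_natCast.mpr hsq) c hc
  intro u hu
  simp only [Finset.mem_image] at hu
  obtain ⟨⟨x, y⟩, hv, rfl⟩ := hu
  rw [← hS _ hv, ← hDf]
  push_cast
  ring

/-- squared norm -/
def nq (x : Fin 3 → ℤ) : ℤ := ∑ i, x i ^ 2

theorem nq_eq (x : Fin 3 → ℤ) : nq x = x 0 ^ 2 + x 1 ^ 2 + x 2 ^ 2 := by
  simp [nq, Fin.sum_univ_three]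

/-- perpendicular vectors of given norm, with third coordinate of `w` nonzero. -/
theorem perp_count (w1 w2 w3 : ℤ) (h3 : w3 ≠ 0) (n R : ℕ)
    (hn : w1 ^ 2 + w2 ^ 2 + w3 ^ 2 = n) (hR : 0 < R)
    (S : Finset (ℤ × ℤ × ℤ)) (hS : ∀ y ∈ S, w1 * y.1 + w2 * y.2.1 + w3 * y.2.2 = 0 ∧
      y.1 ^ 2 + y.2.1 ^ 2 + y.2.2 ^ 2 = R) :
    ∃ c : ℕ, 0 < c ∧ c ≤ n * n * R ∧ S.card ≤ 10 * c.divisors.card ^ 2 := by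
  have ha : 0 < w1 ^ 2 + w3 ^ 2 := by positivity
  have h32 : 0 < w3 ^ 2 := by positivity
  have hcpos : 0 < (w1 ^ 2 + w3 ^ 2) * R * w3 ^ 2 := by positivity
  obtain ⟨c, hc⟩ := Int.eq_ofNat_of_zero_le hcpos.le
  have hn0 : 0 < n := by
    have : (0 : ℤ) < n := by rw [← hn]; positivity
    exact_mod_cast this
  refine ⟨c, ?_, ?_, ?_⟩
  · rw [hc] at hcpos; exact_mod_cast hcpos
  · have : (c : ℤ) ≤ n * n * R := by
      rw [← hc]
      have e1 : w1 ^ 2 + w3 ^ 2 ≤ n := by nlinarith [sq_nonneg w2]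
      have e2 : w3 ^ 2 ≤ n := by nlinarith [sq_nonneg w2, sq_nonneg w1]
      calc (w1 ^ 2 + w3 ^ 2) * R * w3 ^ 2 ≤ n * R * n := by gcongr
        _ = _ := by ring
    exact_mod_cast this
  · have hcard : S.card = (S.image (fun y : ℤ × ℤ × ℤ =>
        ((w1 ^ 2 + w3 ^ 2) * y.1 + w1 * w2 * y.2.1, w3 * y.2.1))).card := by
      rw [Finset.card_image_of_injOn]
      rintro ⟨y1, y2, y3⟩ hy ⟨z1, z2, z3⟩ hz h
      simp only [Prod.mk.injEq] at h ⊢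
      have hy' := hS _ hy
      have hz' := hS _ hz
      simp only at hy' hz'
      have e2 : y2 = z2 := mul_left_cancel₀ h3 h.2
      subst e2
      have e1 : y1 = z1 := mul_left_cancel₀ ha.ne' (by linarith [h.1])
      subst e1
      refine ⟨rfl, rfl, mul_left_cancel₀ h3 (by linarith)⟩
    rw [hcard]
    apply rep_count n hn0 c (by rw [hc] at hcpos; exact_mod_cast hcpos)
    intro u hu
    simp only [Finset.mem_image] at hu
    obtain ⟨⟨y1, y2, y3⟩, hv, rfl⟩ := hu
    obtain ⟨e1, e2⟩ := hS _ hv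
    simp only at e1 e2 ⊢
    have hc' : (c : ℤ) = (w1 ^ 2 + w3 ^ 2) * R * w3 ^ 2 := by rw [hc]
    rw [hc', ← hn, ← e2]
    have e3 : w3 * y3 = -(w1 * y1 + w2 * y2) := by linarith
    have e4 : w3 ^ 2 * y3 ^ 2 = (w1 * y1 + w2 * y2) ^ 2 := by
      calc _ = (w3 * y3) ^ 2 := by ring
        _ = _ := by rw [e3]; ring
    linear_combination (-(w1 ^ 2 + w3 ^ 2)) * e4

theorem circle_count (w : Fin 3 → ℤ) (hw : w ≠ 0) (m : ℕ)
    (S : Finset (Fin 3 → ℤ)) (hS : ∀ x ∈ S, nq x = m ∧ nq (w - x) = m) :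
    S.card ≤ 1 ∨ ∃ c : ℕ, 0 < c ∧ c ≤ 64 * m ^ 3 ∧ S.card ≤ 10 * c.divisors.card ^ 2 := by
  rcases S.eq_empty_or_nonempty with rfl | ⟨x0, hx0⟩
  · left; simp
  have hperp : ∀ x ∈ S, w 0 * (2 * x 0 - w 0) + w 1 * (2 * x 1 - w 1) + w 2 * (2 * x 2 - w 2) = 0
      ∧ (2 * x 0 - w 0) ^ 2 + (2 * x 1 - w 1) ^ 2 + (2 * x 2 - w 2) ^ 2 = 4 * m - nq w := by
    intro x hx
    obtain ⟨h1, h2⟩ := hS x hx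
    simp only [nq_eq, Pi.sub_apply] at h1 h2 ⊢
    constructor
    · linarith
    · linear_combination 2 * h1 + 2 * h2
  have hnn : 0 ≤ nq w := by rw [nq_eq]; positivity
  obtain ⟨n, hn⟩ := Int.eq_ofNat_of_zero_le hnn
  have hRn : 0 ≤ 4 * (m : ℤ) - nq w := by
    rw [← (hperp x0 hx0).2]; positivity
  obtain ⟨R, hR⟩ := Int.eq_ofNat_of_zero_le hRn
  have hR4 : R ≤ 4 * m := by omega
  have hn4 : n ≤ 4 * m := by omega
  rcases Nat.eq_zero_or_pos R with hR0 | hR0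
  · left
    rw [Finset.card_le_one]
    have : ∀ x ∈ S, ∀ i, 2 * x i = w i := by
      intro x hx
      have h := (hperp x hx).2
      rw [hR, hR0] at h
      have h0 := sq_nonneg (2 * x 0 - w 0)
      have h1 := sq_nonneg (2 * x 1 - w 1)
      have h2 := sq_nonneg (2 * x 2 - w 2)
      simp only [Nat.cast_zero] at h
      have e0 : (2 * x 0 - w 0) ^ 2 = 0 := by
        have : ((0 : ℕ) : ℤ) = 0 := rfl
        omega
      have e1 : (2 * x 1 - w 1) ^ 2 = 0 := by
        have : ((0 : ℕ) : ℤ) = 0 := rfl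
        omega
      have e2 : (2 * x 2 - w 2) ^ 2 = 0 := by
        have : ((0 : ℕ) : ℤ) = 0 := rfl
        omega
      have e0 := pow_eq_zero_iff (two_ne_zero) |>.mp e0
      have e1 := pow_eq_zero_iff (two_ne_zero) |>.mp e1
      have e2 := pow_eq_zero_iff (two_ne_zero) |>.mp e2
      intro i
      fin_cases i
      · simp; omega
      · simp; omega
      · simp; omega
    intro x hx y hy
    funext i
    have e1 := this x hx i
    have e2 := this y hy i
    omega
  · right
    have hn' : (w 0) ^ 2 + (w 1) ^ 2 + (w 2) ^ 2 = n := by rw [← nq_eq, hn]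
    have fin : ∀ i j k : Fin 3, (w i) ^ 2 + (w j) ^ 2 + (w k) ^ 2 = n → w k ≠ 0 →
        (∀ x ∈ S, w i * (2 * x i - w i) + w j * (2 * x j - w j) + w k * (2 * x k - w k) = 0
      ∧ (2 * x i - w i) ^ 2 + (2 * x j - w j) ^ 2 + (2 * x k - w k) ^ 2 = 4 * m - nq w) →
      (∀ l : Fin 3, l = i ∨ l = j ∨ l = k) →
      ∃ c : ℕ, 0 < c ∧ c ≤ 64 * m ^ 3 ∧ S.card ≤ 10 * c.divisors.card ^ 2 := by
      intro i j k hijk hk hp hl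
      have hcard : S.card = (S.image (fun x : Fin 3 → ℤ =>
        (2 * x i - w i, 2 * x j - w j, 2 * x k - w k))).card := by
        rw [Finset.card_image_of_injective]
        intro x y hxy
        simp only [Prod.mk.injEq] at hxy
        funext l
        rcases hl l with rfl | rfl | rfl <;> omega
      rw [hcard]
      obtain ⟨c, hc0, hc1, hc2⟩ := perp_count (w i) (w j) (w k) hk n R hijk hR0 (S.image
        (fun x : Fin 3 → ℤ => (2 * x i - w i, 2 * x j - w j, 2 * x k - w k))) (by
          intro y hy
          simp only [Finset.mem_image] at hy
          obtain ⟨x, hx, rfl⟩ := hy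
          have := hp x hx
          rw [hR] at this
          exact this)
      refine ⟨c, hc0, hc1.trans ?_, hc2⟩
      calc n * n * R ≤ (4 * m) * (4 * m) * (4 * m) := by gcongr
        _ = _ := by ring
    by_cases h0 : w 0 = 0
    · by_cases h1 : w 1 = 0
      · have h2 : w 2 ≠ 0 := by
          intro h2
          apply hw
          funext i
          fin_cases i <;> simp [h0, h1, h2]
        exact fin 0 1 2 hn' h2 hperp (by decide)
      · refine fin 0 2 1 (by linarith) h1 ?_ (by decide)
        intro x hx
        have := hperp x hx
        exact ⟨by linarith [this.1], by linarith [this.2]⟩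
    · refine fin 1 2 0 (by linarith) h0 ?_ (by decide)
      intro x hx
      have := hperp x hx
      exact ⟨by linarith [this.1], by linarith [this.2]⟩

theorem circle_bound (ε : ℝ) (hε : 0 < ε) : ∃ C : ℝ, 1 ≤ C ∧
    ∀ m : ℕ, 0 < m → ∀ w : Fin 3 → ℤ, w ≠ 0 → ∀ S : Finset (Fin 3 → ℤ),
      (∀ x ∈ S, nq x = m ∧ nq (w - x) = m) → (S.card : ℝ) ≤ C * (m : ℝ) ^ ε := by
  obtain ⟨C, hC1, hC⟩ := card_divisors_bound (ε / 6) (by positivity)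
  refine ⟨10 * C ^ 2 * 64 ^ (ε / 3), ?_, ?_⟩
  · have h1 : (1 : ℝ) ≤ 64 ^ (ε / 3) := Real.one_le_rpow (by norm_num) (by positivity)
    have h2 : (1 : ℝ) ≤ C ^ 2 := one_le_pow₀ hC1
    nlinarith
  intro m hm w hw S hS
  have hm1 : (1 : ℝ) ≤ m := by exact_mod_cast hm
  have hmε : (1 : ℝ) ≤ (m : ℝ) ^ ε := Real.one_le_rpow hm1 hε.le
  have h64 : (1 : ℝ) ≤ 64 ^ (ε / 3) := Real.one_le_rpow (by norm_num) (by positivity)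
  have hC2 : (1 : ℝ) ≤ C ^ 2 := one_le_pow₀ hC1
  rcases circle_count w hw m S hS with h | ⟨c, hc0, hc1, hc2⟩
  · have : (S.card : ℝ) ≤ 1 := by exact_mod_cast h
    have h3 : (1 : ℝ) ≤ 10 * C ^ 2 * 64 ^ (ε / 3) := by nlinarith
    nlinarith
  · have h1 := hC c hc0.ne'
    have h2 : (S.card : ℝ) ≤ 10 * (c.divisors.card : ℝ) ^ 2 := by exact_mod_cast hc2
    have hcr : (c : ℝ) ≤ 64 * (m : ℝ) ^ 3 := by exact_mod_cast hc1
    have h3 : ((c : ℝ) ^ (ε / 6)) ^ 2 ≤ 64 ^ (ε / 3) * (m : ℝ) ^ ε := by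
      calc ((c : ℝ) ^ (ε / 6)) ^ 2 = (c : ℝ) ^ (ε / 3) := by
            rw [← Real.rpow_natCast, ← Real.rpow_mul (by positivity)]
            congr 1; push_cast; ring
        _ ≤ (64 * (m : ℝ) ^ 3) ^ (ε / 3) := by gcongr
        _ = _ := by
            rw [Real.mul_rpow (by norm_num) (by positivity), ← Real.rpow_natCast,
              ← Real.rpow_mul (by positivity)]
            congr 2; push_cast; ring
    calc (S.card : ℝ) ≤ 10 * (c.divisors.card : ℝ) ^ 2 := h2
      _ ≤ 10 * (C * (c : ℝ) ^ (ε / 6)) ^ 2 := by gcongr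
      _ = 10 * C ^ 2 * ((c : ℝ) ^ (ε / 6)) ^ 2 := by ring
      _ ≤ 10 * C ^ 2 * (64 ^ (ε / 3) * (m : ℝ) ^ ε) := by gcongr
      _ = _ := by ring


open Classical in
theorem offdiag_bound {V : Type*} (T : Finset V) (G : V → ℝ) (hG : ∀ v, 0 ≤ G v) (b : ℝ)
    (hb0 : 0 ≤ b) (hb : ∀ v ∈ T, G v ≤ b) :
    ∑ v ∈ T, G v ≤ 2 * b + Real.sqrt (2 * ∑ u ∈ T, ∑ u' ∈ T with u ≠ u', G u * G u') := by
  set g := ∑ v ∈ T, G v with hg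
  have hg0 : 0 ≤ g := Finset.sum_nonneg (fun v _ => hG v)
  by_cases h : g ≤ 2 * b
  · have := Real.sqrt_nonneg (2 * ∑ u ∈ T, ∑ u' ∈ T with u ≠ u', G u * G u')
    linarith
  · push Not at h
    have h1 : ∀ u ∈ T, ∑ u' ∈ T with u ≠ u', G u * G u' = G u * (g - G u) := by
      intro u hu
      rw [← Finset.mul_sum, Finset.filter_ne, ← Finset.sum_erase_add T G hu] at *
      rw [hg]; ring
    have h2 : g ^ 2 ≤ 2 * ∑ u ∈ T, ∑ u' ∈ T with u ≠ u', G u * G u' := by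
      rw [Finset.sum_congr rfl h1]
      have : ∑ u ∈ T, G u * (g / 2) ≤ ∑ u ∈ T, G u * (g - G u) := by
        apply Finset.sum_le_sum
        intro u hu
        apply mul_le_mul_of_nonneg_left _ (hG u)
        have := hb u hu
        linarith
      rw [← Finset.sum_mul, ← hg] at this
      nlinarith
    have := Real.le_sqrt_of_sq_le h2
    linarith

open Classical in
theorem core {V ι : Type*} [Fintype ι] (W U : Finset V) (F G : V → ℝ)
    (hF : ∀ v, 0 ≤ F v) (hG : ∀ v, 0 ≤ G v) (δ K M : ℝ) (hδ : 0 ≤ δ) (hM0 : 0 ≤ M)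
    (cl : V → ι) (Inc : V → ι → Prop) (Rel : V → V → Prop)
    (hRel : ∀ w u, Rel w u → Inc w (cl u))
    (hK : ∀ w ∈ W, ((univ.filter (fun i => Inc w i)).card : ℝ) ≤ K)
    (hM : ∀ u ∈ U, ∀ u' ∈ U, u ≠ u' → ((W.filter (fun w => Rel w u ∧ Rel w u')).card : ℝ) ≤ M) :
    ∑ w ∈ W, ∑ u ∈ U with (Rel w u ∧ G u ≤ δ * F w), F w * G u ≤
      2 * K * δ * ∑ w ∈ W, F w ^ 2 +
      Real.sqrt (2 * M * (∑ u ∈ U, G u) * ∑ w ∈ W, ∑ u ∈ U with Inc w (cl u), G u * F w ^ 2) := by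
  -- cell data
  set γ : ι → ℝ := fun i => ∑ u ∈ U with cl u = i, G u with hγ
  set T : V → ι → Finset V := fun w i => U.filter (fun u => cl u = i ∧ Rel w u ∧ G u ≤ δ * F w) with hT
  set o : V → ι → ℝ := fun w i => ∑ u ∈ T w i, ∑ u' ∈ T w i with u ≠ u', G u * G u' with ho
  have hγ0 : ∀ i, 0 ≤ γ i := fun i => Finset.sum_nonneg (fun v _ => hG v)
  have ho0 : ∀ w i, 0 ≤ o w i := fun w i => Finset.sum_nonneg (fun v _ =>
    Finset.sum_nonneg (fun v' _ => mul_nonneg (hG v) (hG v')))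
  have step1 : ∀ w ∈ W, ∑ u ∈ U with (Rel w u ∧ G u ≤ δ * F w), F w * G u =
      ∑ i ∈ univ with Inc w i, F w * ∑ u ∈ T w i, G u := by
    intro w hw
    rw [← Finset.sum_fiberwise_of_maps_to (s := U.filter (fun u => Rel w u ∧ G u ≤ δ * F w))
      (t := univ.filter (fun i => Inc w i)) (g := cl)]
    · apply Finset.sum_congr rfl
      intro i _
      rw [Finset.mul_sum]
      apply Finset.sum_congr _ (fun _ _ => rfl)
      ext u
      simp only [hT, Finset.mem_filter]
      tauto
    · intro u hu
      simp only [Finset.mem_filter, Finset.mem_univ, true_and] at hu ⊢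
      exact hRel _ _ hu.2.1
  have step2 : ∀ w i, F w * ∑ u ∈ T w i, G u ≤ 2 * δ * F w ^ 2 + F w * Real.sqrt (2 * o w i) := by
    intro w i
    have := offdiag_bound (T w i) G hG (δ * F w) (mul_nonneg hδ (hF w)) (by
      intro v hv
      simp only [hT, Finset.mem_filter] at hv
      exact hv.2.2.2)
    calc F w * ∑ u ∈ T w i, G u ≤ F w * (2 * (δ * F w) + Real.sqrt (2 * o w i)) :=
          mul_le_mul_of_nonneg_left this (hF w)
      _ = _ := by ring
  -- diagonal term
  have step3 : ∑ w ∈ W, ∑ i ∈ univ with Inc w i, 2 * δ * F w ^ 2 ≤ 2 * K * δ * ∑ w ∈ W, F w ^ 2 := by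
    rw [Finset.mul_sum]
    apply Finset.sum_le_sum
    intro w hw
    rw [Finset.sum_const, nsmul_eq_mul]
    have h1 := hK w hw
    have h2 : 0 ≤ 2 * δ * F w ^ 2 := by have := hF w; positivity
    calc _ ≤ K * (2 * δ * F w ^ 2) := mul_le_mul_of_nonneg_right h1 h2
      _ = _ := by ring
  -- sum of o
  have step4 : ∀ i, ∑ w ∈ W, o w i ≤ M * γ i ^ 2 := by
    intro i
    have h1 : ∀ w, o w i ≤ ∑ u ∈ U with cl u = i, ∑ u' ∈ U with cl u' = i,
        if (u ≠ u' ∧ Rel w u ∧ Rel w u') then G u * G u' else 0 := by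
      intro w
      simp only [ho]
      have hsub : T w i ⊆ U.filter (fun u => cl u = i) := by
        intro u hu
        simp only [hT, Finset.mem_filter] at hu ⊢
        exact ⟨hu.1, hu.2.1⟩
      calc ∑ u ∈ T w i, ∑ u' ∈ T w i with u ≠ u', G u * G u'
          ≤ ∑ u ∈ T w i, ∑ u' ∈ U with cl u' = i,
            if (u ≠ u' ∧ Rel w u ∧ Rel w u') then G u * G u' else 0 := by
            apply Finset.sum_le_sum
            intro u hu
            rw [Finset.sum_filter]
            calc _ = ∑ u' ∈ T w i, if (u ≠ u' ∧ Rel w u ∧ Rel w u') then G u * G u' else 0 := by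
                  apply Finset.sum_congr rfl
                  intro u' hu'
                  simp only [hT, Finset.mem_filter] at hu hu'
                  simp only [hu.2.2.1, hu'.2.2.1, and_true]
              _ ≤ _ := by
                  apply Finset.sum_le_sum_of_subset_of_nonneg hsub
                  intro u' _ _
                  split_ifs
                  · exact mul_nonneg (hG _) (hG _)
                  · exact le_rfl
        _ ≤ _ := by
            apply Finset.sum_le_sum_of_subset_of_nonneg hsub
            intro u _ _
            apply Finset.sum_nonneg
            intro u' _
            split_ifs
            · exact mul_nonneg (hG _) (hG _)
            · exact le_rfl
    calc ∑ w ∈ W, o w i ≤ ∑ w ∈ W, ∑ u ∈ U with cl u = i, ∑ u' ∈ U with cl u' = i,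
        (if (u ≠ u' ∧ Rel w u ∧ Rel w u') then G u * G u' else 0) :=
          Finset.sum_le_sum (fun w _ => h1 w)
      _ = ∑ u ∈ U with cl u = i, ∑ u' ∈ U with cl u' = i, ∑ w ∈ W,
        (if (u ≠ u' ∧ Rel w u ∧ Rel w u') then G u * G u' else 0) := by
          rw [Finset.sum_comm]
          apply Finset.sum_congr rfl
          intro u _
          rw [Finset.sum_comm]
      _ ≤ ∑ u ∈ U with cl u = i, ∑ u' ∈ U with cl u' = i, M * (G u * G u') := by
          apply Finset.sum_le_sum
          intro u hu
          apply Finset.sum_le_sum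
          intro u' hu'
          simp only [Finset.mem_filter] at hu hu'
          have hGG : 0 ≤ G u * G u' := mul_nonneg (hG _) (hG _)
          by_cases hne : u = u'
          · simp only [hne, ne_eq, not_true_eq_false, false_and, if_false, Finset.sum_const_zero]
            exact mul_nonneg hM0 (mul_nonneg (hG _) (hG _))
          · simp only [ne_eq, hne, not_false_eq_true, true_and]
            rw [← Finset.sum_filter, Finset.sum_const, nsmul_eq_mul]
            exact mul_le_mul_of_nonneg_right (hM u hu.1 u' hu'.1 hne) hGG
      _ = M * γ i ^ 2 := by
          simp only [← Finset.mul_sum]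
          simp only [hγ, sq, Finset.sum_mul]
  have hosup : ∀ w ∈ W, ∀ i, γ i = 0 → o w i = 0 := by
    intro w hw i hi
    have := step4 i
    rw [hi] at this
    have h2 : o w i ≤ ∑ w ∈ W, o w i := Finset.single_le_sum (f := fun w => o w i) (fun w _ => ho0 w i) hw
    have := ho0 w i
    nlinarith
  -- Cauchy-Schwarz
  set P : Finset (V × ι) := (W ×ˢ univ).filter (fun p => Inc p.1 p.2) with hP
  have hPsum : ∀ f : V → ι → ℝ, ∑ w ∈ W, ∑ i ∈ univ with Inc w i, f w i = ∑ p ∈ P, f p.1 p.2 := by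
    intro f
    rw [hP, Finset.sum_filter, Finset.sum_product]
    apply Finset.sum_congr rfl
    intro w _
    rw [Finset.sum_filter]
  have step5 : ∑ p ∈ P, F p.1 * Real.sqrt (2 * o p.1 p.2) ≤
      Real.sqrt (2 * M * (∑ u ∈ U, G u) * ∑ w ∈ W, ∑ u ∈ U with Inc w (cl u), G u * F w ^ 2) := by
    apply Real.le_sqrt_of_sq_le
    have e1 : ∀ p ∈ P, F p.1 * Real.sqrt (2 * o p.1 p.2) =
        (F p.1 * Real.sqrt (γ p.2)) * (Real.sqrt (2 * o p.1 p.2) / Real.sqrt (γ p.2)) := by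
      intro p hp
      simp only [hP, Finset.mem_filter, Finset.mem_product] at hp
      by_cases h : γ p.2 = 0
      · simp [hosup p.1 hp.1.1 p.2 h]
      · have : Real.sqrt (γ p.2) ≠ 0 := by
          rw [Real.sqrt_ne_zero']
          exact lt_of_le_of_ne (hγ0 _) (Ne.symm h)
        field_simp
    rw [Finset.sum_congr rfl e1]
    refine (Finset.sum_mul_sq_le_sq_mul_sq _ _ _).trans ?_
    have e2 : ∑ p ∈ P, (F p.1 * Real.sqrt (γ p.2)) ^ 2 =
        ∑ w ∈ W, ∑ u ∈ U with Inc w (cl u), G u * F w ^ 2 := by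
      have : ∀ p ∈ P, (F p.1 * Real.sqrt (γ p.2)) ^ 2 = (fun w i => F w ^ 2 * γ i) p.1 p.2 := by
        intro p _
        rw [mul_pow, Real.sq_sqrt (hγ0 _)]
      rw [Finset.sum_congr rfl this, ← hPsum (fun w i => F w ^ 2 * γ i)]
      apply Finset.sum_congr rfl
      intro w _
      rw [← Finset.sum_fiberwise_of_maps_to (s := U.filter (fun u => Inc w (cl u)))
        (t := univ.filter (fun i => Inc w i)) (g := cl)]
      · apply Finset.sum_congr rfl
        intro i hi
        simp only [Finset.mem_filter, Finset.mem_univ, true_and] at hi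
        simp only [hγ]
        rw [Finset.mul_sum, Finset.filter_filter]
        apply Finset.sum_congr
        · ext u
          simp only [Finset.mem_filter]
          constructor
          · rintro ⟨h1, rfl⟩; exact ⟨h1, hi, rfl⟩
          · rintro ⟨h1, _, h2⟩; exact ⟨h1, h2⟩
        · intros; ring
      · intro u hu
        simp only [Finset.mem_filter, Finset.mem_univ, true_and] at hu ⊢
        exact hu.2
    have e3 : ∑ p ∈ P, (Real.sqrt (2 * o p.1 p.2) / Real.sqrt (γ p.2)) ^ 2 ≤
        2 * M * ∑ u ∈ U, G u := by
      have : ∀ p ∈ P, (Real.sqrt (2 * o p.1 p.2) / Real.sqrt (γ p.2)) ^ 2 =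
          2 * o p.1 p.2 / γ p.2 := by
        intro p _
        rw [div_pow, Real.sq_sqrt (hγ0 _), Real.sq_sqrt (by have := ho0 p.1 p.2; positivity)]
      rw [Finset.sum_congr rfl this]
      calc ∑ p ∈ P, 2 * o p.1 p.2 / γ p.2 ≤ ∑ p ∈ W ×ˢ univ, 2 * o p.1 p.2 / γ p.2 := by
            apply Finset.sum_le_sum_of_subset_of_nonneg (Finset.filter_subset _ _)
            intro p _ _
            have h1 := ho0 p.1 p.2
            have h2 := hγ0 p.2
            positivity
        _ = ∑ i, (2 * ∑ w ∈ W, o w i) / γ i := by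
            rw [Finset.sum_product_right]
            apply Finset.sum_congr rfl
            intro i _
            rw [Finset.mul_sum, Finset.sum_div]
        _ ≤ ∑ i, 2 * M * γ i := by
            apply Finset.sum_le_sum
            intro i _
            have h1 := step4 i
            rcases (hγ0 i).eq_or_lt with h | h
            · rw [← h]; simp
            · rw [div_le_iff₀ h]; nlinarith
        _ = 2 * M * ∑ u ∈ U, G u := by
            rw [← Finset.mul_sum]
            congr 1
            simp only [hγ]
            exact Finset.sum_fiberwise U cl G
    rw [e2, mul_comm]
    apply mul_le_mul_of_nonneg_right e3
    apply Finset.sum_nonneg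
    intro w _
    apply Finset.sum_nonneg
    intro u _
    exact mul_nonneg (hG _) (sq_nonneg _)
  calc ∑ w ∈ W, ∑ u ∈ U with (Rel w u ∧ G u ≤ δ * F w), F w * G u
      = ∑ w ∈ W, ∑ i ∈ univ with Inc w i, F w * ∑ u ∈ T w i, G u := Finset.sum_congr rfl step1
    _ ≤ ∑ w ∈ W, ∑ i ∈ univ with Inc w i, (2 * δ * F w ^ 2 + F w * Real.sqrt (2 * o w i)) :=
        Finset.sum_le_sum (fun w _ => Finset.sum_le_sum (fun i _ => step2 w i))
    _ = ∑ w ∈ W, ∑ i ∈ univ with Inc w i, 2 * δ * F w ^ 2 +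
        ∑ p ∈ P, F p.1 * Real.sqrt (2 * o p.1 p.2) := by
        rw [← hPsum (fun w i => F w * Real.sqrt (2 * o w i)), ← Finset.sum_add_distrib]
        simp only [Finset.sum_add_distrib]
    _ ≤ _ := add_le_add step3 step5

open Classical in
theorem avg_prime (W U : Finset (Fin 3 → ℤ)) (F G : (Fin 3 → ℤ) → ℝ)
    (hG : ∀ v, 0 ≤ G v) (m : ℕ) (Q : Finset ℕ) (hQ : Q.Nonempty) (L H : ℝ)
    (hL0 : 0 ≤ L)
    (hL : ∀ w ∈ W, ∀ u ∈ U, nq (w - u) ≠ m →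
      ((Q.filter (fun q : ℕ => (q : ℤ) ∣ nq (w - u) - m)).card : ℝ) ≤ L)
    (hH : ∀ w ∈ W, ∑ u ∈ U with nq (w - u) = m, G u ≤ H) :
    ∃ q ∈ Q, ∑ w ∈ W, ∑ u ∈ U with (q : ℤ) ∣ nq (w - u) - m, G u * F w ^ 2 ≤
      (L * (∑ u ∈ U, G u) / Q.card + H) * ∑ w ∈ W, F w ^ 2 := by
  have hQc : (0 : ℝ) < Q.card := by exact_mod_cast hQ.card_pos
  apply Finset.exists_le_of_sum_le hQ
  rw [Finset.sum_const, nsmul_eq_mul, Finset.sum_comm]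
  have h1 : ∀ w ∈ W, ∑ q ∈ Q, ∑ u ∈ U with (q : ℤ) ∣ nq (w - u) - m, G u * F w ^ 2 ≤
      (L * (∑ u ∈ U, G u) + Q.card * H) * F w ^ 2 := by
    intro w hw
    calc ∑ q ∈ Q, ∑ u ∈ U with (q : ℤ) ∣ nq (w - u) - m, G u * F w ^ 2
        = ∑ u ∈ U, ((Q.filter (fun q : ℕ => (q : ℤ) ∣ nq (w - u) - m)).card : ℝ) * (G u * F w ^ 2) := by
          simp only [Finset.sum_filter]
          rw [Finset.sum_comm]
          apply Finset.sum_congr rfl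
          intro u _
          rw [← Finset.sum_filter, Finset.sum_const, nsmul_eq_mul]
      _ ≤ ∑ u ∈ U, (L * (G u * F w ^ 2) + Q.card * ((if nq (w - u) = m then G u else 0) * F w ^ 2)) := by
          apply Finset.sum_le_sum
          intro u hu
          have h0 : 0 ≤ G u * F w ^ 2 := mul_nonneg (hG _) (sq_nonneg _)
          split_ifs with h
          · have h2 : ((Q.filter (fun q : ℕ => (q : ℤ) ∣ nq (w - u) - m)).card : ℝ) ≤ Q.card := by
              exact_mod_cast Finset.card_filter_le _ _
            have := mul_le_mul_of_nonneg_right h2 h0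
            have := mul_nonneg hL0 h0
            linarith
          · have := mul_le_mul_of_nonneg_right (hL w hw u hu h) h0
            simpa using this
      _ = (L * (∑ u ∈ U, G u) + Q.card * ∑ u ∈ U with nq (w - u) = m, G u) * F w ^ 2 := by
          rw [Finset.sum_add_distrib, ← Finset.mul_sum, ← Finset.mul_sum, ← Finset.sum_mul,
            ← Finset.sum_mul, Finset.sum_filter]
          ring
      _ ≤ _ := by
          have := hH w hw
          gcongr
  calc _ ≤ ∑ w ∈ W, (L * (∑ u ∈ U, G u) + Q.card * H) * F w ^ 2 := Finset.sum_le_sum h1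
    _ = _ := by
        rw [← Finset.mul_sum]
        field_simp

theorem sq_fiber (q : ℕ) [Fact q.Prime] (a b : ZMod q) :
    (univ.filter (fun x : ZMod q => (a - x) ^ 2 = b)).card ≤ 2 := by
  by_cases h : ∃ x0 : ZMod q, (a - x0) ^ 2 = b
  · obtain ⟨x0, h0⟩ := h
    have : univ.filter (fun x : ZMod q => (a - x) ^ 2 = b) ⊆ {x0, 2 * a - x0} := by
      intro x hx
      simp only [Finset.mem_filter, Finset.mem_univ, true_and] at hx
      simp only [Finset.mem_insert, Finset.mem_singleton]
      rw [← h0] at hx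
      rcases sq_eq_sq_iff_eq_or_eq_neg.mp hx with h | h
      · left; linear_combination -h
      · right; linear_combination -h
    exact (Finset.card_le_card this).trans Finset.card_le_two
  · push Not at h
    rw [Finset.filter_false_of_mem (fun x _ => h x)]
    simp

theorem sphere_mod (q : ℕ) [Fact q.Prime] (w : Fin 3 → ZMod q) (b : ZMod q) :
    (univ.filter (fun x : Fin 3 → ZMod q =>
      (w 0 - x 0) ^ 2 + (w 1 - x 1) ^ 2 + (w 2 - x 2) ^ 2 = b)).card ≤ 2 * q ^ 2 := by
  set S := univ.filter (fun x : Fin 3 → ZMod q =>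
      (w 0 - x 0) ^ 2 + (w 1 - x 1) ^ 2 + (w 2 - x 2) ^ 2 = b) with hS
  calc S.card ≤ 2 * (S.image (fun x => (x 0, x 1))).card := by
        apply Finset.card_le_mul_card_image
        rintro ⟨c, d⟩ _
        refine le_trans ?_ (sq_fiber q (w 2) (b - (w 0 - c) ^ 2 - (w 1 - d) ^ 2))
        apply Finset.card_le_card_of_injOn (fun x => x 2)
        · intro x hx
          simp only [hS, Finset.coe_filter, Finset.mem_filter, Finset.mem_univ, true_and,
            Set.mem_ofPred_eq, Prod.mk.injEq] at hx ⊢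
          obtain ⟨h1, rfl, rfl⟩ := hx
          linear_combination h1
        · intro x hx y hy hxy
          simp only [hS, Finset.coe_filter, Finset.mem_filter, Finset.mem_univ, true_and,
            Set.mem_ofPred_eq, Prod.mk.injEq] at hx hy hxy
          funext i
          fin_cases i
          · simp [hx.2.1, hy.2.1]
          · simp [hx.2.2, hy.2.2]
          · simpa using hxy
    _ ≤ 2 * (univ : Finset (ZMod q × ZMod q)).card := by
        gcongr
        exact Finset.subset_univ _
    _ = 2 * q ^ 2 := by
        rw [Finset.card_univ, Fintype.card_prod, ZMod.card]; ring

open Classical in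
theorem inc_bound (W U : Finset (Fin 3 → ℤ)) (F G : (Fin 3 → ℤ) → ℝ)
    (hF : ∀ v, 0 ≤ F v) (hG : ∀ v, 0 ≤ G v) (m R : ℕ) (hR : 2 ≤ R) (δ M L H : ℝ)
    (hδ : 0 ≤ δ) (hM0 : 0 ≤ M) (hL0 : 0 ≤ L) (Rel : (Fin 3 → ℤ) → (Fin 3 → ℤ) → Prop)
    (hRel : ∀ w u, Rel w u → nq (w - u) = m)
    (hM : ∀ u ∈ U, ∀ u' ∈ U, u ≠ u' → ((W.filter (fun w => Rel w u ∧ Rel w u')).card : ℝ) ≤ M)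
    (hL : ∀ w ∈ W, ∀ u ∈ U, nq (w - u) ≠ m →
      (((Nat.primesLE R).filter (fun q : ℕ => (q : ℤ) ∣ nq (w - u) - m)).card : ℝ) ≤ L)
    (hH : ∀ w ∈ W, ∑ u ∈ U with nq (w - u) = m, G u ≤ H) :
    ∑ w ∈ W, ∑ u ∈ U with (Rel w u ∧ G u ≤ δ * F w), F w * G u ≤
      4 * (R : ℝ) ^ 2 * δ * ∑ w ∈ W, F w ^ 2 +
      Real.sqrt (2 * M * (∑ u ∈ U, G u) *
        ((L * (∑ u ∈ U, G u) / (Nat.primesLE R).card + H) * ∑ w ∈ W, F w ^ 2)) := by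
  have hne : (Nat.primesLE R).Nonempty := ⟨2, by
    rw [Nat.mem_primesLE]; exact ⟨hR, Nat.prime_two⟩⟩
  obtain ⟨q, hq, hqY⟩ := avg_prime W U F G hG m _ hne L H hL0 hL hH
  rw [Nat.mem_primesLE] at hq
  have : Fact q.Prime := ⟨hq.2⟩
  have hinc : ∀ w u : Fin 3 → ℤ, (((w 0 : ZMod q) - (u 0 : ZMod q)) ^ 2 +
      ((w 1 : ZMod q) - (u 1 : ZMod q)) ^ 2 + ((w 2 : ZMod q) - (u 2 : ZMod q)) ^ 2 = (m : ZMod q)) ↔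
      (q : ℤ) ∣ nq (w - u) - m := by
    intro w u
    rw [← ZMod.intCast_zmod_eq_zero_iff_dvd, nq_eq]
    push_cast
    rw [sub_eq_zero]
    simp
  have := core W U F G hF hG δ (2 * (R : ℝ) ^ 2) M hδ hM0
    (fun u => (fun i => (u i : ZMod q) : Fin 3 → ZMod q))
    (fun w x => ((w 0 : ZMod q) - x 0) ^ 2 + ((w 1 : ZMod q) - x 1) ^ 2 +
      ((w 2 : ZMod q) - x 2) ^ 2 = (m : ZMod q)) Rel
    (by
      intro w u h
      rw [hinc, hRel w u h]; simp)
    (by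
      intro w hw
      have h1 := sphere_mod q (fun i => (w i : ZMod q)) (m : ZMod q)
      have h2 : 2 * q ^ 2 ≤ 2 * R ^ 2 := by gcongr; exact hq.1
      have h3 := h1.trans h2
      have h4 : ((univ.filter (fun x : Fin 3 → ZMod q =>
        ((w 0 : ZMod q) - x 0) ^ 2 + ((w 1 : ZMod q) - x 1) ^ 2 +
          ((w 2 : ZMod q) - x 2) ^ 2 = (m : ZMod q))).card : ℝ) ≤ ((2 * R ^ 2 : ℕ) : ℝ) := by
        convert (Nat.cast_le (α := ℝ)).mpr h3
      push_cast at h4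
      convert h4)
    hM
  simp only [hinc] at this
  refine this.trans ?_
  have e : 2 * (2 * (R : ℝ) ^ 2) * δ = 4 * (R : ℝ) ^ 2 * δ := by ring
  rw [e]
  gcongr
  · exact mul_nonneg (by positivity) (Finset.sum_nonneg (fun v _ => hG v))


/-- real-valued representation function -/
def rep (A : Finset (Fin 3 → ℤ)) : ℕ → (Fin 3 → ℤ) → ℝ
  | 0, w => if w = 0 then 1 else 0
  | t + 1, w => ∑ a ∈ A, rep A t (w - a)

/-- iterated sumset -/
def supp (A : Finset (Fin 3 → ℤ)) : ℕ → Finset (Fin 3 → ℤ)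
  | 0 => {0}
  | t + 1 => (A ×ˢ supp A t).image (fun p => p.1 + p.2)

theorem rep_nonneg (A : Finset (Fin 3 → ℤ)) (t : ℕ) (w) : 0 ≤ rep A t w := by
  induction t generalizing w with
  | zero => simp only [rep]; split_ifs <;> norm_num
  | succ t ih => simp only [rep]; exact Finset.sum_nonneg (fun a _ => ih _)

theorem add_mem_supp {A : Finset (Fin 3 → ℤ)} {t : ℕ} {a v : Fin 3 → ℤ} (ha : a ∈ A)
    (hv : v ∈ supp A t) : a + v ∈ supp A (t + 1) := by
  simp only [supp, Finset.mem_image, Finset.mem_product, Prod.exists]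
  exact ⟨a, v, ⟨ha, hv⟩, rfl⟩

theorem rep_supp {A : Finset (Fin 3 → ℤ)} {t : ℕ} {w} (h : rep A t w ≠ 0) : w ∈ supp A t := by
  induction t generalizing w with
  | zero => 
    simp only [rep] at h
    simp only [supp, Finset.mem_singleton]
    by_contra h'
    simp [h'] at h
  | succ t ih => 
    simp only [rep] at h
    obtain ⟨a, ha, h2⟩ := Finset.exists_ne_zero_of_sum_ne_zero h
    have := add_mem_supp ha (ih h2)
    simpa using this

theorem sum_shift (f : (Fin 3 → ℤ) → ℝ) (S : Finset (Fin 3 → ℤ)) (g : (Fin 3 → ℤ) → (Fin 3 → ℤ))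
    (hg : Function.Injective g) : ∑ w ∈ S, f (g w) = ∑ w ∈ S.image g, f w := by
  rw [Finset.sum_image (fun x _ y _ h => hg h)]

theorem rep_sum_le (A : Finset (Fin 3 → ℤ)) (t : ℕ) (S : Finset (Fin 3 → ℤ)) :
    ∑ w ∈ S, rep A t w ≤ (A.card : ℝ) ^ t := by
  induction t generalizing S with
  | zero => 
    simp only [rep, Finset.sum_ite_eq', pow_zero]
    split_ifs <;> norm_num
  | succ t ih => 
    simp only [rep]
    rw [Finset.sum_comm]
    calc _ ≤ ∑ a ∈ A, (A.card : ℝ) ^ t := by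
          apply Finset.sum_le_sum
          intro a _
          rw [sum_shift (rep A t) S (fun w => w - a) (sub_left_injective)]
          exact ih _
      _ = _ := by rw [Finset.sum_const, nsmul_eq_mul]; ring

theorem rep_le (A : Finset (Fin 3 → ℤ)) (t : ℕ) (w : Fin 3 → ℤ) :
    rep A (t + 1) w ≤ (A.card : ℝ) ^ t := by
  simp only [rep]
  rw [sum_shift (rep A t) A (fun a => w - a) (sub_right_injective)]
  exact rep_sum_le _ _ _

theorem sum_le_supp (A : Finset (Fin 3 → ℤ)) (t : ℕ) (S : Finset (Fin 3 → ℤ)) 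
    (f : (Fin 3 → ℤ) → ℝ) (hf : ∀ w, 0 ≤ f w) (h0 : ∀ w, rep A t w = 0 → f w = 0) :
    ∑ w ∈ S, f w ≤ ∑ w ∈ supp A t, f w := by
  calc _ = ∑ w ∈ S with w ∈ supp A t, f w := by
        rw [Finset.sum_filter]
        apply Finset.sum_congr rfl
        intro w _
        split_ifs with h
        · rfl
        · apply h0
          by_contra h'
          exact h (rep_supp h')
    _ ≤ _ := by
        apply Finset.sum_le_sum_of_subset_of_nonneg
        · intro w hw
          exact (Finset.mem_filter.mp hw).2
        · intro w _ _; exact hf w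

theorem sum_eq_supp (A : Finset (Fin 3 → ℤ)) (t : ℕ) (S : Finset (Fin 3 → ℤ)) 
    (f : (Fin 3 → ℤ) → ℝ) (h0 : ∀ w, rep A t w = 0 → f w = 0) 
    (hS : ∀ w ∈ supp A t, f w ≠ 0 → w ∈ S) :
    ∑ w ∈ supp A t, f w = ∑ w ∈ S, f w := by
  have h1 : ∑ w ∈ supp A t with w ∈ S, f w = ∑ w ∈ supp A t, f w := by
    rw [Finset.sum_filter]
    apply Finset.sum_congr rfl
    intro w hw
    split_ifs with h
    · rfl
    · by_contra h'
      exact h (hS w hw (Ne.symm h'))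
  rw [← h1]
  apply Finset.sum_subset
  · intro w hw; exact (Finset.mem_filter.mp hw).2
  · intro w hw hw'
    apply h0
    by_contra h'
    exact hw' (Finset.mem_filter.mpr ⟨rep_supp h', hw⟩)

/-- energy -/
def En (A : Finset (Fin 3 → ℤ)) (t : ℕ) : ℝ := ∑ w ∈ supp A t, rep A t w ^ 2

theorem En_nonneg (A) (t : ℕ) : 0 ≤ En A t := Finset.sum_nonneg (fun _ _ => sq_nonneg _)

theorem sum_sq_le (A : Finset (Fin 3 → ℤ)) (t : ℕ) (S : Finset (Fin 3 → ℤ)) :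
    ∑ w ∈ S, rep A t w ^ 2 ≤ En A t :=
  sum_le_supp A t S _ (fun _ => sq_nonneg _) (fun w h => by simp [h])

theorem sum_sq_le' (A : Finset (Fin 3 → ℤ)) (t : ℕ) (n) (S : Finset (Fin 3 → ℤ)) :
    ∑ w ∈ S, rep A t (n - w) ^ 2 ≤ En A t := by
  rw [sum_shift (fun w => rep A t w ^ 2) S (fun w => n - w) sub_right_injective]
  exact sum_sq_le A t _

theorem rep_succ (A : Finset (Fin 3 → ℤ)) (t : ℕ) (w : Fin 3 → ℤ) :
    rep A (t + 1) w = ∑ u ∈ supp A t with w - u ∈ A, rep A t u := by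
  simp only [rep]
  rw [sum_shift (rep A t) A (fun a => w - a) sub_right_injective, Finset.sum_filter]
  have h1 : ∀ u, (if w - u ∈ A then rep A t u else 0) ≠ 0 → u ∈ A.image (fun a => w - a) := by
    intro u h
    split_ifs at h with h2
    · exact Finset.mem_image.mpr ⟨w - u, h2, by simp⟩
    · simp at h
  rw [sum_eq_supp A t (A.image (fun a => w - a)) (fun u => if w - u ∈ A then rep A t u else 0)
    (fun u h => by simp [h]) (fun u _ h => h1 u h)]
  apply Finset.sum_congr rfl
  intro u hu
  obtain ⟨a, ha, rfl⟩ := Finset.mem_image.mp hu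
  simp [ha]

theorem rep_add (A : Finset (Fin 3 → ℤ)) (j l : ℕ) (n : Fin 3 → ℤ) :
    rep A (j + l) n = ∑ w ∈ supp A j, rep A j w * rep A l (n - w) := by
  induction j generalizing n with
  | zero => simp [rep, supp]
  | succ j ih => 
    have e : j + 1 + l = (j + l) + 1 := by ring
    rw [e]
    simp only [rep, Finset.sum_mul]
    rw [Finset.sum_comm]
    apply Finset.sum_congr rfl
    intro a ha
    rw [ih, sum_shift (fun w => rep A j w * rep A l (n - a - w)) _ (fun w => w)
      Function.injective_id]
    have : ∀ x, rep A j (x - a) * rep A l (n - x) = 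
      (fun w => rep A j w * rep A l (n - a - w)) (x - a) := by
      intro x
      simp
    simp only [this]
    rw [sum_shift (fun w => rep A j w * rep A l (n - a - w)) _ (fun w => w - a) sub_left_injective]
    simp only [Finset.image_id']
    apply sum_eq_supp
    · intro w h; simp [h]
    · intro w hw _
      rw [Finset.mem_image]
      exact ⟨a + w, add_mem_supp ha hw, by simp⟩

theorem rep_two_mul_le (A : Finset (Fin 3 → ℤ)) (t : ℕ) (n : Fin 3 → ℤ) :
    rep A (2 * t) n ≤ En A t := by
  rw [two_mul, rep_add]
  have h1 : ∑ w ∈ supp A t, rep A t w * rep A t (n - w) ≤ 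
      ∑ w ∈ supp A t, (rep A t w ^ 2 + rep A t (n - w) ^ 2) / 2 := by
    apply Finset.sum_le_sum
    intro w _
    nlinarith [sq_nonneg (rep A t w - rep A t (n - w))]
  rw [← Finset.sum_div, Finset.sum_add_distrib] at h1
  have h2 := sum_sq_le A t (supp A t)
  have h3 := sum_sq_le' A t n (supp A t)
  linarith

theorem sum_sum_rep (A : Finset (Fin 3 → ℤ)) (t : ℕ) (T : Finset (Fin 3 → ℤ)) :
    ∑ u ∈ T, rep A (t + 1) u = 
      ∑ v ∈ supp A t, rep A t v * ((T.filter (fun u => u - v ∈ A)).card : ℝ) := by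
  simp only [rep_succ, Finset.sum_filter]
  rw [Finset.sum_comm]
  apply Finset.sum_congr rfl
  intro v _
  rw [← Finset.sum_filter, Finset.sum_const, nsmul_eq_mul, mul_comm]

theorem H_bound (A : Finset (Fin 3 → ℤ)) (m : ℕ) (hA : ∀ a ∈ A, nq a = m) (M : ℝ) (hM0 : 0 ≤ M)
    (hM : ∀ w ≠ 0, ∀ S : Finset (Fin 3 → ℤ), (∀ x ∈ S, nq x = m ∧ nq (w - x) = m) → (S.card : ℝ) ≤ M)
    (l : ℕ) (w : Fin 3 → ℤ) (T : Finset (Fin 3 → ℤ)) :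
    ∑ u ∈ T with nq (w - u) = m, rep A (l + 2) u ≤ (M + 1) * (A.card : ℝ) ^ (l + 1) := by
  rw [sum_sum_rep]
  have h1 : ∀ v ∈ supp A (l + 1), rep A (l + 1) v * 
      (((T.filter (fun u => nq (w - u) = m)).filter (fun u => u - v ∈ A)).card : ℝ) ≤
      M * rep A (l + 1) v + (if v = w then (A.card : ℝ) * rep A (l + 1) w else 0) := by
    intro v _
    by_cases h : v = w
    · subst h
      rw [if_pos rfl]
      have : ((T.filter (fun u => nq (v - u) = m)).filter (fun u => u - v ∈ A)).card ≤ A.card := by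
        apply Finset.card_le_card_of_injOn (fun u => u - v)
        · intro u hu
          simp only [Finset.coe_filter, Set.mem_ofPred_eq] at hu
          exact hu.2
        · intro x _ y _ hxy
          exact sub_left_injective hxy
      have h2 : (((T.filter (fun u => nq (v - u) = m)).filter (fun u => u - v ∈ A)).card : ℝ) 
        ≤ A.card := by exact_mod_cast this
      have h3 := rep_nonneg A (l + 1) v
      nlinarith [mul_nonneg hM0 h3]
    · rw [if_neg h, add_zero, mul_comm]
      gcongr
      · exact rep_nonneg _ _ _
      · have := hM (w - v) (sub_ne_zero.mpr (Ne.symm h)) 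
          (((T.filter (fun u => nq (w - u) = m)).filter (fun u => u - v ∈ A)).image (fun u => w - u))
          (by 
            intro x hx
            obtain ⟨u, hu, rfl⟩ := Finset.mem_image.mp hx
            simp only [Finset.mem_filter] at hu
            refine ⟨hu.1.2, ?_⟩
            have e : w - v - (w - u) = u - v := by abel
            rw [e]
            exact hA _ hu.2)
        rwa [Finset.card_image_of_injective _ sub_right_injective] at this
  refine (Finset.sum_le_sum h1).trans ?_
  rw [Finset.sum_add_distrib, ← Finset.mul_sum, Finset.sum_ite_eq']
  have h2 := rep_sum_le A (l + 1) (supp A (l + 1))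
  have h3 := rep_le A l w
  have h4 : (if w ∈ supp A (l + 1) then (A.card : ℝ) * rep A (l + 1) w else 0) ≤ 
      (A.card : ℝ) ^ (l + 1) := by
    split_ifs
    · rw [pow_succ, mul_comm]; gcongr
    · positivity
  nlinarith [mul_le_mul_of_nonneg_left h2 hM0]

theorem rep_one (A : Finset (Fin 3 → ℤ)) (w : Fin 3 → ℤ) : 
    rep A 1 w = if w ∈ A then 1 else 0 := by
  simp only [rep, sub_eq_zero]
  rw [Finset.sum_ite_eq]

theorem E2_bound (A : Finset (Fin 3 → ℤ)) (m : ℕ) (hA : ∀ a ∈ A, nq a = m) (M : ℝ) (hM0 : 0 ≤ M)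
    (hM : ∀ w ≠ 0, ∀ S : Finset (Fin 3 → ℤ), (∀ x ∈ S, nq x = m ∧ nq (w - x) = m) → (S.card : ℝ) ≤ M) :
    En A 2 ≤ (M + 1) * (A.card : ℝ) ^ 2 := by
  have h1 : ∀ w ∈ supp A 2, rep A 2 w ^ 2 ≤ M * rep A 2 w + 
      (if w = 0 then (A.card : ℝ) ^ 2 else 0) := by
    intro w _
    have h0 := rep_nonneg A 2 w
    by_cases h : w = 0
    · rw [if_pos h]
      have h3 := rep_le A 1 w
      rw [pow_one] at h3
      have : rep A 2 w ^ 2 ≤ (A.card : ℝ) ^ 2 := by 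
        gcongr
      nlinarith [mul_nonneg hM0 h0]
    · rw [if_neg h, add_zero, sq]
      gcongr
      have : rep A 2 w = ((A.filter (fun a => w - a ∈ A)).card : ℝ) := by
        rw [rep]
        simp only [rep_one, Finset.sum_boole]
      rw [this]
      apply hM w h
      intro x hx
      rw [Finset.mem_filter] at hx
      exact ⟨hA _ hx.1, hA _ hx.2⟩
  refine (Finset.sum_le_sum h1).trans ?_
  rw [Finset.sum_add_distrib, ← Finset.mul_sum, Finset.sum_ite_eq']
  have h2 := rep_sum_le A 2 (supp A 2)
  have h4 : (if (0 : Fin 3 → ℤ) ∈ supp A 2 then (A.card : ℝ) ^ 2 else 0) ≤ (A.card : ℝ) ^ 2 := by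
    split_ifs
    · rfl
    · positivity
  nlinarith [mul_le_mul_of_nonneg_left h2 hM0]

theorem coord_le (m : ℕ) (a : Fin 3 → ℤ) (ha : nq a = m) (i : Fin 3) : |a i| ≤ m := by
  have h1 : a i ^ 2 ≤ m := by
    rw [← ha, nq]
    exact Finset.single_le_sum (f := fun i => a i ^ 2) (fun j _ => sq_nonneg (a j)) (Finset.mem_univ i)
  have h2 : |a i| ≤ |a i| ^ 2 := Int.le_self_sq _
  rw [sq_abs] at h2
  linarith

theorem supp_coord (A : Finset (Fin 3 → ℤ)) (m : ℕ) (hA : ∀ a ∈ A, nq a = m) (t : ℕ) 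
    (u : Fin 3 → ℤ) (hu : u ∈ supp A t) (i : Fin 3) : |u i| ≤ t * m := by
  induction t generalizing u with
  | zero => 
    simp only [supp, Finset.mem_singleton] at hu
    simp [hu]
  | succ t ih => 
    simp only [supp, Finset.mem_image, Finset.mem_product, Prod.exists] at hu
    obtain ⟨a, v, ⟨ha, hv⟩, rfl⟩ := hu
    have h1 := ih v hv
    have h2 := coord_le m a (hA a ha) i
    have h3 := abs_add_le (a i) (v i)
    push_cast
    rw [Pi.add_apply]
    linarith

theorem card_A_le (A : Finset (Fin 3 → ℤ)) (m : ℕ) (hA : ∀ a ∈ A, nq a = m) : 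
    A.card ≤ (2 * m + 1) ^ 3 := by
  have : A ⊆ Fintype.piFinset (fun _ : Fin 3 => Finset.Icc (-(m : ℤ)) m) := by
    intro a ha
    rw [Fintype.mem_piFinset]
    intro i
    rw [Finset.mem_Icc]
    exact abs_le.mp (coord_le m a (hA a ha) i)
  refine (Finset.card_le_card this).trans ?_
  rw [Fintype.card_piFinset]
  simp only [Int.card_Icc, Finset.prod_const, Finset.card_univ, Fintype.card_fin]
  apply le_of_eq
  congr 1
  omega

theorem pi_lower (R : ℕ) (hR : 2 ≤ R) : 
    (R : ℝ) ≤ 8 * ((Nat.primesLE R).card : ℝ) * (1 + Real.log R) := by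
  rw [Nat.primesLE_card_eq_primeCounting]
  have h1 := Chebyshev.pi_ge R
  have hR' : (2 : ℝ) ≤ R := by exact_mod_cast hR
  have hl : 0 < Real.log R := Real.log_pos (by linarith)
  have hp : (1 : ℝ) ≤ (Nat.primeCounting R : ℝ) := by
    have h2 : Nat.primeCounting 2 ≤ Nat.primeCounting R := Nat.monotone_primeCounting hR
    have h3 : Nat.primeCounting 2 = 1 := by decide
    rw [h3] at h2
    exact_mod_cast h2
  rcases lt_or_ge R 8 with h | h
  · have : (R : ℝ) ≤ 8 := by exact_mod_cast h.le
    nlinarith [mul_nonneg (zero_le_one.trans hp) hl.le]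
  · rw [div_le_iff₀ hl] at h1
    have h5 : (R + 1) ^ 2 ≤ 2 ^ R := by
      clear h1 hl hR' hp hR
      induction R, h using Nat.le_induction with
      | base => norm_num
      | succ n hn ih => 
        rw [pow_succ 2]
        nlinarith
    have h6 : 2 * Real.log (R + 1) ≤ R * Real.log 2 := by
      have : ((R : ℝ) + 1) ^ 2 ≤ 2 ^ R := by exact_mod_cast h5
      have := Real.log_le_log (by positivity) this
      rw [Real.log_pow, Real.log_pow] at this
      exact_mod_cast this
    have h7 := Real.log_two_gt_d9
    have : (R : ℝ) * 0.5 ≤ R * Real.log 2 := by gcongr; linarith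
    nlinarith


structure Pack (m B : ℕ) (A : Finset (Fin 3 → ℤ)) (Θ : ℝ) : Prop where
  one_le : 1 ≤ Θ
  hM : ∀ w ≠ 0, ∀ S : Finset (Fin 3 → ℤ), (∀ x ∈ S, nq x = m ∧ nq (w - x) = m) → 
    (S.card : ℝ) ≤ Θ - 1
  hL : ∀ v : Fin 3 → ℤ, (∀ i, |v i| ≤ B * m) → nq v ≠ m → ∀ S : Finset ℕ,
    ((S.filter (fun q : ℕ => (q : ℤ) ∣ nq v - m)).card : ℝ) ≤ Θ
  hR : ∀ R : ℕ, 2 ≤ R → R ≤ 3 * A.card → (R : ℝ) ≤ Θ * (Nat.primesLE R).card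

theorem exists_pack (B : ℕ) (hB : 1 ≤ B) (η : ℝ) (hη : 0 < η) : ∃ C : ℝ, 1 ≤ C ∧ 
    ∀ m : ℕ, 0 < m → ∀ A : Finset (Fin 3 → ℤ), (∀ a ∈ A, nq a = m) →
      Pack m B A (C * (m : ℝ) ^ η) := by
  obtain ⟨C1, hC1, h1⟩ := circle_bound η hη
  obtain ⟨C2, hC2, h2⟩ := card_divisors_bound (η / 2) (by positivity)
  have hB' : (1 : ℝ) ≤ B := by exact_mod_cast hB
  set D2 : ℝ := C2 * (4 * (B : ℝ) ^ 2) ^ (η / 2) with hD2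
  set D3 : ℝ := 8 * (1 + (81 : ℝ) ^ (η / 3) * (3 / η)) with hD3
  have hD2' : 0 ≤ D2 := by positivity
  have hD3' : 0 ≤ D3 := by positivity
  refine ⟨C1 + 1 + D2 + D3, by linarith, ?_⟩
  intro m hm A hA
  have hm1 : (1 : ℝ) ≤ m := by exact_mod_cast hm
  have hX : 1 ≤ (m : ℝ) ^ η := Real.one_le_rpow hm1 hη.le
  set X := (m : ℝ) ^ η with hXd
  have e1 : 0 ≤ C1 * X := by positivity
  have e2 : 0 ≤ D2 * X := by positivity
  have e3 : 0 ≤ D3 * X := by positivity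
  refine ⟨by nlinarith, ?_, ?_, ?_⟩
  · intro w hw S hS
    have := h1 m hm w hw S hS
    nlinarith
  · intro v hv hne S
    have hz : nq v - m ≠ 0 := sub_ne_zero.mpr hne
    have hz' : (nq v - m).natAbs ≠ 0 := by simpa using hz
    have hcard : (S.filter (fun q : ℕ => (q : ℤ) ∣ nq v - m)).card ≤ 
        (nq v - m).natAbs.divisors.card := by
      apply Finset.card_le_card
      intro q hq
      rw [Finset.mem_filter] at hq
      rw [Nat.mem_divisors]
      exact ⟨Int.natCast_dvd.mp hq.2, hz'⟩
    have hle : (nq v - m).natAbs ≤ 4 * B ^ 2 * m ^ 2 := by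
      have hsq : ∀ i, v i ^ 2 ≤ (B * m : ℤ) ^ 2 := fun i => sq_le_sq' 
        (by linarith [(abs_le.mp (hv i)).1]) (abs_le.mp (hv i)).2
      have g0 := hsq 0
      have g1 := hsq 1
      have g2 := hsq 2
      have p0 := sq_nonneg (v 0)
      have p1 := sq_nonneg (v 1)
      have p2 := sq_nonneg (v 2)
      have hBm : (m : ℤ) ≤ (B * m : ℤ) ^ 2 := by
        have : m ≤ (B * m) ^ 2 := by
          calc m = 1 * m := by ring
            _ ≤ B * m := by gcongr
            _ ≤ _ := Nat.le_self_pow (by norm_num) _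
        exact_mod_cast this
      have : |nq v - m| ≤ ((4 * B ^ 2 * m ^ 2 : ℕ) : ℤ) := by
        rw [abs_le, nq_eq]
        push_cast
        have : (0 : ℤ) ≤ m := by positivity
        constructor <;> nlinarith
      have h5 : (((nq v - m).natAbs : ℕ) : ℤ) ≤ ((4 * B ^ 2 * m ^ 2 : ℕ) : ℤ) := by
        rw [Int.natCast_natAbs]; exact this
      exact_mod_cast h5
    have h5 : (((S.filter (fun q : ℕ => (q : ℤ) ∣ nq v - m)).card : ℕ) : ℝ) ≤ D2 * X := by
      calc (((S.filter (fun q : ℕ => (q : ℤ) ∣ nq v - m)).card : ℕ) : ℝ) 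
          ≤ ((nq v - m).natAbs.divisors.card : ℝ) := by exact_mod_cast hcard
        _ ≤ C2 * ((nq v - m).natAbs : ℝ) ^ (η / 2) := h2 _ hz'
        _ ≤ C2 * (4 * (B : ℝ) ^ 2 * (m : ℝ) ^ 2) ^ (η / 2) := by
            gcongr
            exact_mod_cast hle
        _ = _ := by
            rw [Real.mul_rpow (by positivity) (by positivity), ← Real.rpow_natCast (m : ℝ) 2, 
              ← Real.rpow_mul (by positivity), hD2, hXd]
            have : ((2 : ℕ) : ℝ) * (η / 2) = η := by push_cast; ring
            rw [this]; ring
    nlinarith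
  · intro R hR2 hR3
    have g1 := pi_lower R hR2
    have hk := card_A_le A m hA
    have hR' : R ≤ 81 * m ^ 3 := by
      have : (2 * m + 1) ^ 3 ≤ (3 * m) ^ 3 := by gcongr; omega
      nlinarith
    have hlog : Real.log R ≤ (81 : ℝ) ^ (η / 3) * (3 / η) * X := by
      calc Real.log R ≤ (R : ℝ) ^ (η / 3) / (η / 3) := 
            Real.log_le_rpow_div (by positivity) (by positivity)
        _ ≤ (81 * (m : ℝ) ^ 3) ^ (η / 3) / (η / 3) := by
            gcongr
            exact_mod_cast hR'
        _ = _ := by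
            rw [Real.mul_rpow (by positivity) (by positivity), ← Real.rpow_natCast (m : ℝ) 3, 
              ← Real.rpow_mul (by positivity), hXd]
            have : ((3 : ℕ) : ℝ) * (η / 3) = η := by push_cast; ring
            rw [this]; field_simp
    calc (R : ℝ) ≤ 8 * ((Nat.primesLE R).card : ℝ) * (1 + Real.log R) := g1
      _ ≤ 8 * ((Nat.primesLE R).card : ℝ) * (X + (81 : ℝ) ^ (η / 3) * (3 / η) * X) := by gcongr
      _ = (D3 * X) * (Nat.primesLE R).card := by rw [hD3]; ring
      _ ≤ _ := by gcongr; nlinarith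

open Classical in
theorem inc_pack (m B : ℕ) (A : Finset (Fin 3 → ℤ)) (hA : ∀ a ∈ A, nq a = m) (hne : A.Nonempty)
    (Θ : ℝ) (hP : Pack m B A Θ) (j R : ℕ) (hR2 : 2 ≤ R) (hR3 : R ≤ 3 * A.card) 
    (W : Finset (Fin 3 → ℤ)) (F : (Fin 3 → ℤ) → ℝ) (hF : ∀ v, 0 ≤ F v) (δ : ℝ) (hδ : 0 ≤ δ)
    (hc : ∀ w ∈ W, ∀ u ∈ supp A (j + 2), ∀ i, |(w - u) i| ≤ B * m) :
    ∑ w ∈ W, ∑ u ∈ supp A (j + 2) with (w - u ∈ A ∧ rep A (j + 2) u ≤ δ * F w), 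
      F w * rep A (j + 2) u ≤
    4 * (R : ℝ) ^ 2 * δ * ∑ w ∈ W, F w ^ 2 +
      Real.sqrt (8 * Θ ^ 3 * ((A.card : ℝ) ^ (j + 2)) ^ 2 / R * ∑ w ∈ W, F w ^ 2) := by
  have hΘ := hP.one_le
  have hk : 0 < A.card := hne.card_pos
  have hk' : (0 : ℝ) < A.card := by exact_mod_cast hk
  have hRpos : (0 : ℝ) < R := by exact_mod_cast (by omega : 0 < R)
  refine le_trans (le_of_eq ?_) (le_trans (inc_bound W (supp A (j + 2)) F (rep A (j + 2)) hF (rep_nonneg A _) m R hR2 δ (Θ - 1) Θ 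
    (Θ * (A.card : ℝ) ^ (j + 1)) hδ (by linarith) (by linarith) (fun w u => w - u ∈ A) 
    (fun w u h => hA _ h) ?_ ?_ ?_) ?_)
  · apply Finset.sum_congr rfl
    intro w _
    apply Finset.sum_congr _ (fun _ _ => rfl)
    ext u
    simp only [Finset.mem_filter]
  · intro u _ u' _ huu
    have := hP.hM (u' - u) (sub_ne_zero.mpr (Ne.symm huu)) 
      ((W.filter (fun w => w - u ∈ A ∧ w - u' ∈ A)).image (fun w => w - u)) ?_
    · rw [Finset.card_image_of_injective _ sub_left_injective] at this
      convert this
    · intro x hx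
      obtain ⟨w, hw, rfl⟩ := Finset.mem_image.mp hx
      rw [Finset.mem_filter] at hw
      refine ⟨hA _ hw.2.1, ?_⟩
      have := hA _ hw.2.2
      rw [nq_eq] at this ⊢
      rw [← this]
      simp only [Pi.sub_apply]
      ring
  · intro w hw u hu hne
    exact hP.hL _ (hc w hw u hu) hne _
  · intro w _
    have := H_bound A m hA (Θ - 1) (by linarith) hP.hM j w (supp A (j + 2))
    rwa [sub_add_cancel] at this
  · have hG := rep_sum_le A (j + 2) (supp A (j + 2))
    have hG0 : 0 ≤ ∑ u ∈ supp A (j + 2), rep A (j + 2) u := 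
      Finset.sum_nonneg (fun v _ => rep_nonneg A _ v)
    have hF2 : 0 ≤ ∑ w ∈ W, F w ^ 2 := Finset.sum_nonneg (fun v _ => sq_nonneg _)
    set g := ∑ u ∈ supp A (j + 2), rep A (j + 2) u
    set K := (A.card : ℝ) ^ (j + 2) with hK
    have hK0 : 0 ≤ K := by positivity
    gcongr _ + Real.sqrt ?_
    have hπ := hP.hR R hR2 hR3
    have hπ0 : (0 : ℝ) < (Nat.primesLE R).card := by
      by_contra h
      push Not at h
      nlinarith
    have a1 : Θ * g / (Nat.primesLE R).card ≤ Θ ^ 2 * K / R := by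
      rw [div_le_div_iff₀ hπ0 hRpos]
      calc Θ * g * R ≤ Θ * K * (Θ * (Nat.primesLE R).card) := by gcongr
        _ = _ := by ring
    have a2 : Θ * (A.card : ℝ) ^ (j + 1) ≤ 3 * Θ ^ 2 * K / R := by
      rw [le_div_iff₀ hRpos]
      have : (R : ℝ) ≤ 3 * A.card := by exact_mod_cast hR3
      calc Θ * (A.card : ℝ) ^ (j + 1) * R ≤ Θ * (A.card : ℝ) ^ (j + 1) * (3 * A.card) := by gcongr
        _ = 3 * Θ * K := by rw [hK]; ring
        _ ≤ 3 * Θ ^ 2 * K := by gcongr; nlinarith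
    calc _ ≤ 2 * Θ * K * ((Θ ^ 2 * K / R + 3 * Θ ^ 2 * K / R) * ∑ w ∈ W, F w ^ 2) := by
          gcongr
          · linarith
      _ = _ := by field_simp; ring

theorem even_step (m B : ℕ) (A : Finset (Fin 3 → ℤ)) (hA : ∀ a ∈ A, nq a = m) (hne : A.Nonempty)
    (Θ : ℝ) (hP : Pack m B A Θ) (j R : ℕ) (hB : 4 * j + 10 ≤ B) (hR2 : 2 ≤ R) 
    (hR3 : R ≤ 3 * A.card) :
    En A (j + 3) ≤ 2 * (16 * (R : ℝ) ^ 2 * A.card * En A (j + 2) + 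
      8 * Θ ^ 3 * ((A.card : ℝ) ^ (j + 2)) ^ 2 / R) := by
  classical
  have hRpos : (0 : ℝ) < R := by exact_mod_cast (by omega : 0 < R)
  set δ : ℝ := 1 / (16 * (R : ℝ) ^ 2) with hδ
  have hδ0 : 0 < δ := by positivity
  have hΘ := hP.one_le
  set W := supp A (j + 3)
  set U := supp A (j + 2) with hU
  set F := rep A (j + 3) with hF
  set G := rep A (j + 2) with hG
  have hF0 : ∀ v, 0 ≤ F v := rep_nonneg A _
  have hG0 : ∀ v, 0 ≤ G v := rep_nonneg A _
  have h1 := inc_pack m B A hA hne Θ hP j R hR2 hR3 W F hF0 δ hδ0.le (by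
    intro w hw u hu i
    have a1 := supp_coord A m hA _ w hw i
    have a2 := supp_coord A m hA _ u hu i
    have a3 := abs_sub (w i) (u i)
    rw [Pi.sub_apply]
    push_cast at a1 a2
    have : (4 * j + 10 : ℤ) ≤ B := by exact_mod_cast hB
    have hm0 : (0 : ℤ) ≤ m := by positivity
    have hj0 : (0 : ℤ) ≤ j := by positivity
    nlinarith [mul_le_mul_of_nonneg_right this hm0, mul_nonneg hj0 hm0])
  have hEn : ∑ w ∈ W, F w ^ 2 = En A (j + 3) := rfl
  have h2 : ∑ w ∈ W, ∑ u ∈ U with (w - u ∈ A ∧ ¬ (G u ≤ δ * F w)), F w * G u ≤ 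
      A.card * En A (j + 2) / δ := by
    calc _ ≤ ∑ w ∈ W, ∑ u ∈ U with (w - u ∈ A), G u ^ 2 / δ := by
          apply Finset.sum_le_sum
          intro w _
          rw [Finset.sum_filter, Finset.sum_filter]
          apply Finset.sum_le_sum
          intro u _
          have := hG0 u
          split_ifs with a b b
          · have h3 := a.2
            push Not at h3
            rw [le_div_iff₀ hδ0]
            nlinarith
          · exact absurd a.1 b
          · positivity
          · rfl
      _ = ∑ u ∈ U, G u ^ 2 / δ * ((W.filter (fun w => w - u ∈ A)).card : ℝ) := by
          simp only [Finset.sum_filter]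
          rw [Finset.sum_comm]
          apply Finset.sum_congr rfl
          intro u _
          rw [← Finset.sum_filter, Finset.sum_const, nsmul_eq_mul, mul_comm]
      _ ≤ ∑ u ∈ U, G u ^ 2 / δ * A.card := by
          apply Finset.sum_le_sum
          intro u hu
          apply mul_le_mul_of_nonneg_left _ (by positivity)
          apply Nat.cast_le.mpr
          apply Finset.card_le_card_of_injOn (fun w => w - u)
          · intro w hw
            simp only [Finset.coe_filter, Set.mem_ofPred_eq] at hw
            exact hw.2
          · intro x _ y _ hxy
            exact sub_left_injective hxy
      _ = _ := by
          rw [← Finset.sum_mul, ← Finset.sum_div, En]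
          ring
  have h3 : En A (j + 3) = ∑ w ∈ W, ∑ u ∈ U with (w - u ∈ A ∧ G u ≤ δ * F w), F w * G u + 
      ∑ w ∈ W, ∑ u ∈ U with (w - u ∈ A ∧ ¬ (G u ≤ δ * F w)), F w * G u := by
    rw [← hEn, ← Finset.sum_add_distrib]
    apply Finset.sum_congr rfl
    intro w _
    rw [← Finset.filter_filter, ← Finset.filter_filter, Finset.sum_filter_add_sum_filter_not,
      ← Finset.mul_sum, sq]
    congr 1
    exact rep_succ A (j + 2) w
  rw [hEn] at h1
  set E := En A (j + 3)
  have hE0 : 0 ≤ E := En_nonneg _ _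
  set X := 8 * Θ ^ 3 * ((A.card : ℝ) ^ (j + 2)) ^ 2 / R with hX
  have hX0 : 0 ≤ X := by positivity
  have h4 : Real.sqrt (X * E) ≤ X + E / 4 := by
    apply Real.sqrt_le_iff.mpr
    constructor
    · positivity
    · nlinarith [sq_nonneg (X - E / 4)]
  have h5 : 4 * (R : ℝ) ^ 2 * δ = 1 / 4 := by rw [hδ]; field_simp; norm_num
  have h6 : A.card * En A (j + 2) / δ = 16 * (R : ℝ) ^ 2 * A.card * En A (j + 2) := by
    rw [hδ]; field_simp
  rw [h5] at h1
  rw [h6] at h2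
  linarith

theorem odd_step (m B : ℕ) (A : Finset (Fin 3 → ℤ)) (hA : ∀ a ∈ A, nq a = m) (hne : A.Nonempty)
    (Θ : ℝ) (hP : Pack m B A Θ) (j R : ℕ) (hB : 4 * j + 10 ≤ B) (hR2 : 2 ≤ R) 
    (hR3 : R ≤ 3 * A.card) (n : Fin 3 → ℤ) :
    rep A (2 * (j + 2) + 1) n ≤ 2 * (4 * (R : ℝ) ^ 2 * En A (j + 2) + 
      Real.sqrt (8 * Θ ^ 3 * ((A.card : ℝ) ^ (j + 2)) ^ 2 / R * En A (j + 2))) := by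
  classical
  have hΘ := hP.one_le
  have hE0 : 0 ≤ En A (j + 2) := En_nonneg _ _
  by_cases hn : rep A (2 * (j + 2) + 1) n = 0
  · rw [hn]; positivity
  have hn' := rep_supp hn
  set U := supp A (j + 2) with hU
  set G := rep A (j + 2) with hG
  have hG0 : ∀ v, 0 ≤ G v := rep_nonneg A _
  set F : (Fin 3 → ℤ) → ℝ := fun w => G (n - w) with hF
  set W := U.image (fun v => n - v) with hW
  have h1 := inc_pack m B A hA hne Θ hP j R hR2 hR3 W F (fun v => hG0 _) 1 zero_le_one (by
    intro w hw u hu i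
    obtain ⟨v, hv, rfl⟩ := Finset.mem_image.mp hw
    have a1 := supp_coord A m hA _ v hv i
    have a2 := supp_coord A m hA _ u hu i
    have a4 := supp_coord A m hA _ n hn' i
    have a3 := abs_sub (n i - v i) (u i)
    have a5 := abs_sub (n i) (v i)
    rw [Pi.sub_apply, Pi.sub_apply]
    push_cast at a1 a2 a4
    have : (4 * j + 10 : ℤ) ≤ B := by exact_mod_cast hB
    have hm0 : (0 : ℤ) ≤ m := by positivity
    nlinarith [mul_le_mul_of_nonneg_right this hm0])
  have hEW : ∑ w ∈ W, F w ^ 2 ≤ En A (j + 2) := sum_sq_le' A (j + 2) n W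
  set S : ℝ := ∑ v ∈ U, ∑ u ∈ U with (n - v - u ∈ A ∧ G u ≤ G v), G v * G u with hS
  have hSeq : ∑ w ∈ W, ∑ u ∈ U with (w - u ∈ A ∧ G u ≤ 1 * F w), F w * G u = S := by
    rw [hW, Finset.sum_image (fun x _ y _ h => sub_right_injective h)]
    simp only [hF, one_mul, sub_sub_cancel, hS]
  have h2 : rep A (2 * (j + 2) + 1) n = S + 
      ∑ v ∈ U, ∑ u ∈ U with (n - v - u ∈ A ∧ ¬ (G u ≤ G v)), G v * G u := by
    have e : 2 * (j + 2) + 1 = (j + 2) + (j + 2 + 1) := by ring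
    rw [e, rep_add, hS, ← Finset.sum_add_distrib]
    apply Finset.sum_congr rfl
    intro v _
    rw [← Finset.filter_filter, ← Finset.filter_filter, Finset.sum_filter_add_sum_filter_not,
      ← Finset.mul_sum, rep_succ A (j + 2) (n - v)]
  have h3 : ∑ v ∈ U, ∑ u ∈ U with (n - v - u ∈ A ∧ ¬ (G u ≤ G v)), G v * G u ≤ S := by
    rw [hS]
    simp only [Finset.sum_filter]
    rw [Finset.sum_comm]
    apply Finset.sum_le_sum
    intro u _
    apply Finset.sum_le_sum
    intro v _
    have e : n - v - u = n - u - v := by abel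
    have := mul_nonneg (hG0 u) (hG0 v)
    rw [e, mul_comm (G v)]
    split_ifs with a b b
    · rfl
    · exact absurd ⟨a.1, (not_le.mp a.2).le⟩ b
    · exact this
    · rfl
  rw [hSeq, mul_one] at h1
  have h4 : S ≤ 4 * (R : ℝ) ^ 2 * En A (j + 2) + 
      Real.sqrt (8 * Θ ^ 3 * ((A.card : ℝ) ^ (j + 2)) ^ 2 / R * En A (j + 2)) := by
    refine h1.trans ?_
    gcongr
  linarith


theorem exists_R (k : ℕ) (hk : 1 ≤ k) (θ : ℝ) (h0 : 0 ≤ θ) (h1 : θ ≤ 1) :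
    ∃ R : ℕ, 2 ≤ R ∧ R ≤ 3 * k ∧ (k : ℝ) ^ θ ≤ R ∧ (R : ℝ) ≤ 3 * (k : ℝ) ^ θ := by
  have hk' : (1 : ℝ) ≤ k := by exact_mod_cast hk
  have hr : 1 ≤ (k : ℝ) ^ θ := Real.one_le_rpow hk' h0
  have hr2 : (k : ℝ) ^ θ ≤ k := by
    calc (k : ℝ) ^ θ ≤ (k : ℝ) ^ (1 : ℝ) := Real.rpow_le_rpow_of_exponent_le hk' h1
      _ = k := Real.rpow_one _
  set r := (k : ℝ) ^ θ
  have hc : 1 ≤ ⌈r⌉₊ := Nat.one_le_ceil_iff.mpr (by linarith)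
  have hc2 := Nat.le_ceil r
  have hc3 := Nat.ceil_lt_add_one (a := r) (by linarith)
  have hu : ((⌈r⌉₊ + 1 : ℕ) : ℝ) ≤ 3 * r := by push_cast; linarith
  refine ⟨⌈r⌉₊ + 1, by omega, ?_, by push_cast; linarith, hu⟩
  have : ((⌈r⌉₊ + 1 : ℕ) : ℝ) ≤ ((3 * k : ℕ) : ℝ) := by push_cast at hu ⊢; linarith
  exact_mod_cast this

/-- the exponents -/
def mu (j : ℕ) : ℝ := 1 / 2 * (1 / 3) ^ j

theorem mu_pos (j : ℕ) : 0 < mu j := by unfold mu; positivity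

theorem mu_le (j : ℕ) : mu j ≤ 1 / 2 := by
  unfold mu
  have : ((1 : ℝ) / 3) ^ j ≤ 1 := pow_le_one₀ (by norm_num) (by norm_num)
  linarith

theorem mu_succ (j : ℕ) : mu j = 3 * mu (j + 1) := by
  unfold mu; rw [pow_succ]; ring

theorem energy_bound (j : ℕ) : ∀ ε : ℝ, 0 < ε → ∃ C : ℝ, 1 ≤ C ∧ 
    ∀ m : ℕ, 0 < m → ∀ A : Finset (Fin 3 → ℤ), (∀ a ∈ A, nq a = m) → A.Nonempty →
      En A (j + 2) ≤ C * (m : ℝ) ^ ε * (A.card : ℝ) ^ (2 * (j : ℝ) + 3 / 2 + mu j) := by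
  induction j with
  | zero => 
    intro ε hε
    obtain ⟨C, hC, h⟩ := exists_pack 1 le_rfl ε hε
    refine ⟨C, hC, ?_⟩
    intro m hm A hA hne
    have hP := h m hm A hA
    have h1 := E2_bound A m hA (C * (m : ℝ) ^ ε - 1) (by linarith [hP.one_le]) hP.hM
    rw [sub_add_cancel] at h1
    have e : 2 * ((0 : ℕ) : ℝ) + 3 / 2 + mu 0 = ((2 : ℕ) : ℝ) := by unfold mu; norm_num
    rw [e, Real.rpow_natCast]
    exact h1
  | succ j ih => 
    intro ε hε
    obtain ⟨C1, hC1, h1⟩ := ih ε hε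
    obtain ⟨C2, hC2, h2⟩ := exists_pack (4 * j + 10) (by omega) (ε / 3) (by positivity)
    refine ⟨2 * (144 * C1 + 8 * C2 ^ 3), by nlinarith [pow_pos (zero_lt_one.trans_le hC2) 3], ?_⟩
    intro m hm A hA hne
    have hk : 1 ≤ A.card := hne.card_pos
    have hk' : (0 : ℝ) < A.card := by exact_mod_cast hk
    have hm' : (0 : ℝ) < m := by exact_mod_cast hm
    have hP := h2 m hm A hA
    have g1 := mu_pos (j + 1)
    have g2 := mu_le (j + 1)
    have g3 := mu_succ j
    obtain ⟨R, hR2, hR3, hRl, hRu⟩ := exists_R A.card hk (1 / 2 - mu (j + 1)) (by linarith) (by linarith)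
    have hs := even_step m _ A hA hne _ hP j R le_rfl hR2 hR3
    have hE := h1 m hm A hA hne
    refine hs.trans ?_
    set k : ℝ := (A.card : ℝ)
    set X := (m : ℝ) ^ ε with hX
    have hX3 : ((m : ℝ) ^ (ε / 3)) ^ 3 = X := by
      rw [← Real.rpow_natCast, ← Real.rpow_mul hm'.le, hX]
      congr 1; push_cast; ring
    set K := k ^ (2 * ((j + 1 : ℕ) : ℝ) + 3 / 2 + mu (j + 1)) with hK
    have hX0 : 0 < X := by positivity
    have b1 : 16 * (R : ℝ) ^ 2 * k * En A (j + 2) ≤ 144 * C1 * X * K := by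
      calc 16 * (R : ℝ) ^ 2 * k * En A (j + 2) 
          ≤ 16 * (3 * k ^ (1 / 2 - mu (j + 1))) ^ 2 * k * (C1 * X * k ^ (2 * (j : ℝ) + 3 / 2 + mu j)) := by
            have hE0 := En_nonneg A (j + 2)
            gcongr
        _ = 144 * C1 * X * ((k ^ (1 / 2 - mu (j + 1))) ^ 2 * k * k ^ (2 * (j : ℝ) + 3 / 2 + mu j)) := by ring
        _ = 144 * C1 * X * K := by
            congr 1
            rw [← Real.rpow_natCast, ← Real.rpow_mul hk'.le, ← Real.rpow_add_one hk'.ne', 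
              ← Real.rpow_add hk', hK]
            congr 1
            push_cast
            rw [g3]; ring
    have b2 : 8 * (C2 * (m : ℝ) ^ (ε / 3)) ^ 3 * (k ^ (j + 2)) ^ 2 / R ≤ 8 * C2 ^ 3 * X * K := by
      calc 8 * (C2 * (m : ℝ) ^ (ε / 3)) ^ 3 * (k ^ (j + 2)) ^ 2 / R 
          ≤ 8 * (C2 * (m : ℝ) ^ (ε / 3)) ^ 3 * (k ^ (j + 2)) ^ 2 / k ^ (1 / 2 - mu (j + 1)) := by
            gcongr
        _ = 8 * C2 ^ 3 * X * ((k ^ (j + 2)) ^ 2 / k ^ (1 / 2 - mu (j + 1))) := by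
            rw [mul_pow, hX3]; ring
        _ = _ := by
            congr 1
            rw [← pow_mul, ← Real.rpow_natCast, ← Real.rpow_sub hk', hK]
            congr 1
            push_cast
            ring
    calc _ ≤ 2 * (144 * C1 * X * K + 8 * C2 ^ 3 * X * K) := by gcongr
      _ = _ := by ring

theorem odd_bound (j : ℕ) (ε : ℝ) (hε : 0 < ε) : ∃ C : ℝ, 1 ≤ C ∧ 
    ∀ m : ℕ, 0 < m → ∀ A : Finset (Fin 3 → ℤ), (∀ a ∈ A, nq a = m) → A.Nonempty → ∀ n,
      rep A (2 * (j + 2) + 1) n ≤ 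
        C * (m : ℝ) ^ ε * (A.card : ℝ) ^ (2 * (j : ℝ) + 5 / 2 + 3 / 5 * mu j) := by
  obtain ⟨C1, hC1, h1⟩ := energy_bound j ε hε
  obtain ⟨C2, hC2, h2⟩ := exists_pack (4 * j + 10) (by omega) (ε / 3) (by positivity)
  refine ⟨2 * (36 * C1 + Real.sqrt (8 * C2 ^ 3 * C1)), 
    by nlinarith [Real.sqrt_nonneg (8 * C2 ^ 3 * C1)], ?_⟩
  intro m hm A hA hne n
  have hk : 1 ≤ A.card := hne.card_pos
  have hk' : (0 : ℝ) < A.card := by exact_mod_cast hk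
  have hm' : (0 : ℝ) < m := by exact_mod_cast hm
  have hP := h2 m hm A hA
  have g1 := mu_pos j
  have g2 := mu_le j
  obtain ⟨R, hR2, hR3, hRl, hRu⟩ := exists_R A.card hk (1 / 2 - mu j / 5) (by linarith) (by linarith)
  have hs := odd_step m _ A hA hne _ hP j R le_rfl hR2 hR3 n
  have hE := h1 m hm A hA hne
  have hE0 := En_nonneg A (j + 2)
  refine hs.trans ?_
  set k : ℝ := (A.card : ℝ)
  set X := (m : ℝ) ^ ε with hX
  have hX3 : ((m : ℝ) ^ (ε / 3)) ^ 3 = X := by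
    rw [← Real.rpow_natCast, ← Real.rpow_mul hm'.le, hX]
    congr 1; push_cast; ring
  set K := k ^ (2 * (j : ℝ) + 5 / 2 + 3 / 5 * mu j) with hK
  have hX0 : 0 < X := by positivity
  have hK0 : 0 < K := by positivity
  have b1 : 4 * (R : ℝ) ^ 2 * En A (j + 2) ≤ 36 * C1 * X * K := by
    calc 4 * (R : ℝ) ^ 2 * En A (j + 2) 
        ≤ 4 * (3 * k ^ (1 / 2 - mu j / 5)) ^ 2 * (C1 * X * k ^ (2 * (j : ℝ) + 3 / 2 + mu j)) := by
          gcongr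
      _ = 36 * C1 * X * ((k ^ (1 / 2 - mu j / 5)) ^ 2 * k ^ (2 * (j : ℝ) + 3 / 2 + mu j)) := by ring
      _ = 36 * C1 * X * K := by
          congr 1
          rw [← Real.rpow_natCast, ← Real.rpow_mul hk'.le, ← Real.rpow_add hk', hK]
          congr 1
          push_cast
          ring
  have b2 : Real.sqrt (8 * (C2 * (m : ℝ) ^ (ε / 3)) ^ 3 * (k ^ (j + 2)) ^ 2 / R * En A (j + 2)) ≤ 
      Real.sqrt (8 * C2 ^ 3 * C1) * X * K := by
    calc _ ≤ Real.sqrt (8 * (C2 * (m : ℝ) ^ (ε / 3)) ^ 3 * (k ^ (j + 2)) ^ 2 / k ^ (1 / 2 - mu j / 5) 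
            * (C1 * X * k ^ (2 * (j : ℝ) + 3 / 2 + mu j))) := by
          gcongr
      _ = Real.sqrt ((8 * C2 ^ 3 * C1) * (X * K) ^ 2) := by
          congr 1
          rw [mul_pow C2, hX3]
          have : (k ^ (j + 2)) ^ 2 / k ^ (1 / 2 - mu j / 5) * k ^ (2 * (j : ℝ) + 3 / 2 + mu j) = K ^ 2 := by
            rw [← pow_mul, ← Real.rpow_natCast, ← Real.rpow_sub hk', ← Real.rpow_add hk', hK,
              ← Real.rpow_natCast, ← Real.rpow_mul hk'.le]
            congr 1
            push_cast
            ring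
          rw [mul_pow X, ← this]; ring
      _ = _ := by
          rw [Real.sqrt_mul (by positivity), Real.sqrt_sq (by positivity)]; ring
  calc _ ≤ 2 * (36 * C1 * X * K + Real.sqrt (8 * C2 ^ 3 * C1) * X * K) := by gcongr
    _ = _ := by ring

theorem repCount_succ (A : Finset (Fin 3 → ℤ)) (s : ℕ) (n : Fin 3 → ℤ) :
    repCount (s + 1) (A : Set (Fin 3 → ℤ)) n = 
      ∑ a ∈ A, repCount s (A : Set (Fin 3 → ℤ)) (n - a) := by
  have hfin : ∀ v : Fin 3 → ℤ, Finite {x : Fin s → (Fin 3 → ℤ) // 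
      (∀ i, x i ∈ (A : Set (Fin 3 → ℤ))) ∧ ∑ i, x i = v} := by
    intro v
    have : {x : Fin s → (Fin 3 → ℤ) | 
      (∀ i, x i ∈ (A : Set (Fin 3 → ℤ))) ∧ ∑ i, x i = v}.Finite := by
      apply Set.Finite.subset (Set.Finite.pi' (fun _ : Fin s => A.finite_toSet))
      intro x hx
      exact hx.1
    exact this.to_subtype
  let e : {x : Fin (s + 1) → (Fin 3 → ℤ) // 
      (∀ i, x i ∈ (A : Set (Fin 3 → ℤ))) ∧ ∑ i, x i = n} ≃ 
      (Σ a : A, {x : Fin s → (Fin 3 → ℤ) // 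
      (∀ i, x i ∈ (A : Set (Fin 3 → ℤ))) ∧ ∑ i, x i = n - (a : Fin 3 → ℤ)}) :=
    { toFun := fun x => ⟨⟨x.1 0, x.2.1 0⟩, ⟨fun i => x.1 i.succ, fun i => x.2.1 _, by
        have := x.2.2
        rw [Fin.sum_univ_succ] at this
        exact eq_sub_of_add_eq' this⟩⟩
      invFun := fun y => ⟨Fin.cons y.1.1 y.2.1, by
        refine ⟨fun i => ?_, ?_⟩
        · refine Fin.cases ?_ (fun i => ?_) i
          · simp
          · simpa using y.2.2.1 i
        · rw [Fin.sum_univ_succ]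
          simp only [Fin.cons_zero, Fin.cons_succ]
          rw [y.2.2.2]; simp⟩
      left_inv := by
        intro x
        apply Subtype.ext
        exact Fin.cons_self_tail x.1
      right_inv := by
        intro y
        rfl }
  rw [repCount, Nat.card_congr e, Nat.card_sigma]
  exact Finset.sum_coe_sort A (fun a => repCount s (A : Set (Fin 3 → ℤ)) (n - a))

theorem repCount_eq (A : Finset (Fin 3 → ℤ)) (s : ℕ) (n : Fin 3 → ℤ) :
    (repCount s (A : Set (Fin 3 → ℤ)) n : ℝ) = rep A s n := by
  induction s generalizing n with
  | zero => 
    rw [repCount, rep]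
    by_cases h : n = 0
    · subst h
      simp
    · have : IsEmpty {x : Fin 0 → (Fin 3 → ℤ) // 
        (∀ i, x i ∈ (A : Set (Fin 3 → ℤ))) ∧ ∑ i, x i = n} := by
        refine ⟨fun x => h ?_⟩
        rw [← x.2.2]; simp
      rw [Nat.card_of_isEmpty, if_neg h]; simp
  | succ s ih => 
    rw [repCount_succ, rep]
    push_cast
    exact Finset.sum_congr rfl (fun a _ => ih _)

theorem statement_3 (s : ℕ) (hs : 4 ≤ s) (ε : ℝ) (hε : 0 < ε) :
    ∃ C : ℝ, 0 < C ∧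
      ∀ m : ℕ, 0 < m → ∀ A : Set (Fin 3 → ℤ), A.Finite → A.Nonempty → A ⊆ latSphere 3 m →
        (↑(⨆ n : Fin 3 → ℤ, repCount s A n) : ℝ) ≤ C * (m : ℝ) ^ ε *
          (A.ncard : ℝ) ^
            ((s : ℝ) - 3 + 1 / 2 +
              (if Even s then (1 / 2) * (3 : ℝ) ^ (-(s : ℝ) / 2 + 2)
               else (1 / 10) * (3 : ℝ) ^ (-((s : ℝ) - 1) / 2 + 3))) := by
  have key : ∃ C : ℝ, 1 ≤ C ∧ 
    ∀ m : ℕ, 0 < m → ∀ A : Finset (Fin 3 → ℤ), (∀ a ∈ A, nq a = m) → A.Nonempty → ∀ n,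
      rep A s n ≤ C * (m : ℝ) ^ ε * (A.card : ℝ) ^ 
        ((s : ℝ) - 3 + 1 / 2 +
              (if Even s then (1 / 2) * (3 : ℝ) ^ (-(s : ℝ) / 2 + 2)
               else (1 / 10) * (3 : ℝ) ^ (-((s : ℝ) - 1) / 2 + 3))) := by
    rcases Nat.even_or_odd s with h | h
    · obtain ⟨t, ht⟩ := h
      obtain ⟨j, rfl⟩ : ∃ j, t = j + 2 := ⟨t - 2, by omega⟩
      have ht' : s = 2 * (j + 2) := by omega
      obtain ⟨C, hC, hb⟩ := energy_bound j ε hε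
      refine ⟨C, hC, ?_⟩
      intro m hm A hA hne n
      have h2 := hb m hm A hA hne
      have h3 := rep_two_mul_le A (j + 2) n
      rw [← ht'] at h3
      have e : (s : ℝ) - 3 + 1 / 2 + (if Even s then (1 / 2) * (3 : ℝ) ^ (-(s : ℝ) / 2 + 2)
               else (1 / 10) * (3 : ℝ) ^ (-((s : ℝ) - 1) / 2 + 3)) = 2 * (j : ℝ) + 3 / 2 + mu j := by
        rw [if_pos ⟨_, ht⟩, ht', mu]
        push_cast
        have e2 : -(2 * ((j : ℝ) + 2)) / 2 + 2 = - (j : ℝ) := by ring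
        rw [e2, Real.rpow_neg (by norm_num), Real.rpow_natCast, one_div, one_div, inv_pow]
        ring
      rw [e]
      exact h3.trans h2
    · obtain ⟨t, ht⟩ := h
      obtain ⟨j, rfl⟩ : ∃ j, t = j + 2 := ⟨t - 2, by omega⟩
      obtain ⟨C, hC, hb⟩ := odd_bound j ε hε
      refine ⟨C, hC, ?_⟩
      intro m hm A hA hne n
      have h2 := hb m hm A hA hne n
      rw [← ht] at h2
      have e : (s : ℝ) - 3 + 1 / 2 + (if Even s then (1 / 2) * (3 : ℝ) ^ (-(s : ℝ) / 2 + 2)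
               else (1 / 10) * (3 : ℝ) ^ (-((s : ℝ) - 1) / 2 + 3)) = 
               2 * (j : ℝ) + 5 / 2 + 3 / 5 * mu j := by
        rw [if_neg (Nat.not_even_iff_odd.mpr ⟨_, ht⟩), ht, mu]
        push_cast
        have e2 : -(2 * ((j : ℝ) + 2) + 1 - 1) / 2 + 3 = - (j : ℝ) + 1 := by ring
        rw [e2, Real.rpow_add_one (by norm_num), Real.rpow_neg (by norm_num), Real.rpow_natCast, 
          one_div, one_div, one_div, inv_pow]
        ring
      rw [e]
      exact h2
  obtain ⟨C, hC, hb⟩ := key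
  refine ⟨C, by linarith, ?_⟩
  intro m hm A hfin hne hsub
  lift A to Finset (Fin 3 → ℤ) using hfin
  rw [Set.ncard_coe_finset]
  have hA : ∀ a ∈ A, nq a = m := fun a ha => hsub ha
  have hb' := hb m hm A hA (by simpa using hne)
  obtain ⟨n, hn⟩ : ∃ n, repCount s (A : Set (Fin 3 → ℤ)) n = 
      ⨆ n, repCount s (A : Set (Fin 3 → ℤ)) n := by
    apply Nat.sSup_mem (Set.range_nonempty _)
    refine ⟨⌊C * (m : ℝ) ^ ε * (A.card : ℝ) ^ 
        ((s : ℝ) - 3 + 1 / 2 +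
              (if Even s then (1 / 2) * (3 : ℝ) ^ (-(s : ℝ) / 2 + 2)
               else (1 / 10) * (3 : ℝ) ^ (-((s : ℝ) - 1) / 2 + 3)))⌋₊, ?_⟩
    rintro _ ⟨n, rfl⟩
    apply Nat.le_floor
    rw [repCount_eq]
    exact hb' n
  rw [← hn, repCount_eq]
  exact hb' n
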